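/- Let (R,m,k) be a commutative noetherian local ring that has a dualizing complex and let c(t) be a polynomial with integer coefficients. The following are equivalent: (1) c(t)·P^R_M(t) is a polynomial in Z[t] for every finitely generated R-module M; (2) c(t)·P^R_M(t) is a Laurent polynomial in Z[t,t^{-1}] for every complex M of R-modules with bounded, degreewise finitely generated homology; (3) c(t)·I_R^M(t) is a Laurent polynomial in Z[t,t^{-1}] for every complex M of R-modules with bounded, degreewise finitely generated homology. -/

import Mathlib

open CategoryTheory CategoryTheory.Limits CochainComplex.HomComplex

noncomputable section

/-- The category of cochain complexes of `R`-modules indexed by `ℤ`.  We identify a chain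
complex with homology `H_i` with the cochain complex whose cohomology in degree `n` is
`H_{-n}`. -/
abbrev Cx (R : Type) [CommRing R] := CochainComplex (ModuleCat R) ℤ

/-- The complex consisting of the module `M` concentrated in degree `0`. -/
abbrev sgl {R : Type} [CommRing R] (M : ModuleCat R) : Cx R :=
  (HomologicalComplex.single (ModuleCat R) (ComplexShape.up ℤ) 0).obj M

/-- `π : F ⟶ M` is a semiprojective resolution of `M`:  `F` is a bounded above
complex of projective modules and `π` is a quasi-isomorphism. -/
def IsSemiprojResolution {R : Type} [CommRing R] {F M : Cx R} (π : F ⟶ M) : Prop :=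
  (∀ n : ℤ, Projective (F.X n)) ∧ (∃ b : ℤ, ∀ n : ℤ, b ≤ n → IsZero (F.X n)) ∧ QuasiIso π

/-- Vanishing of the hyper-Ext group `Ext^i(M, N)`:  computed from any semiprojective
resolution `F` of `M`, every `i`-cocycle of the Hom-complex `Hom(F, N)` is a coboundary. -/
def ExtVanishes {R : Type} [CommRing R] (M N : Cx R) (i : ℤ) : Prop :=
  ∀ (F : Cx R) (π : F ⟶ M), IsSemiprojResolution π →
    ∀ f : Cochain F N i, δ i (i+1) f = 0 → ∃ g : Cochain F N (i-1), δ (i-1) i g = f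

/-- The `i`-th hyper-Ext module computed from a resolution `F` of the first variable:
the cocycles modulo the coboundaries in the Hom-complex `Hom(F, N)`. -/
abbrev extModule (R : Type) [CommRing R] (F N : Cx R) (i : ℤ) :=
  ↥(LinearMap.ker (δ_hom R F N i (i+1))) ⧸
    (Submodule.comap (LinearMap.ker (δ_hom R F N i (i+1))).subtype
      (LinearMap.range (δ_hom R F N (i-1) i)))

/-- `Ext^i(M, N) ≅ k`, the residue field of the local ring `R`. -/
def ExtIsResidueField (R : Type) [CommRing R] [IsLocalRing R] (M N : Cx R) (i : ℤ) : Prop :=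
  ∀ (F : Cx R) (π : F ⟶ M), IsSemiprojResolution π →
    Nonempty ((extModule R F N i) ≃ₗ[R] (R ⧸ IsLocalRing.maximalIdeal R))

/-- `D` is a dualizing complex for the local ring `R`, normalized so that
`H_i(D) = 0` for `i < 0` and `H_0(D) ≠ 0` (recall `H_i(D) = H^{-i}(D)`):  it has bounded,
degreewise finitely generated homology and `Ext^i(k, D)` is `k` for exactly one `i` and
zero otherwise. -/
structure IsNormalizedDualizingComplex (R : Type) [CommRing R] [IsLocalRing R] (D : Cx R) :
    Prop where
  finite_homology : ∀ n : ℤ, Module.Finite R (D.homology n)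
  homology_bounded : ∃ a : ℤ, ∀ n : ℤ, n < a → IsZero (D.homology n)
  vanish_neg : ∀ n : ℤ, 0 < n → IsZero (D.homology n)
  nonzero_zero : ¬ IsZero (D.homology 0)
  ext_residue : ∃ d : ℤ,
    ExtIsResidueField R (sgl (ModuleCat.of R (R ⧸ IsLocalRing.maximalIdeal R))) D d ∧
    ∀ i : ℤ, i ≠ d →
      ExtVanishes (sgl (ModuleCat.of R (R ⧸ IsLocalRing.maximalIdeal R))) D i

/-- The depth of a local ring: the smallest `i` with `Ext^i(k, R) ≠ 0`. -/
def ringDepth (R : Type) [CommRing R] [IsLocalRing R] : ℕ∞ :=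
  sInf { n : ℕ∞ | ∃ i : ℕ, n = i ∧
    ¬ IsZero (((Ext R (ModuleCat R) i).obj
        (Opposite.op (ModuleCat.of R (R ⧸ IsLocalRing.maximalIdeal R)))).obj
        (ModuleCat.of R R)) }

/-- A local ring is Cohen-Macaulay if its depth equals its Krull dimension. -/
def IsCohenMacaulayLocalRing (R : Type) [CommRing R] [IsLocalRing R] : Prop :=
  (ringDepth R : WithBot ℕ∞) = ringKrullDim R

/-- `R` has finite injective dimension as a module over itself. -/
def HasFiniteSelfInjDim (R : Type) [CommRing R] : Prop :=
  ∃ n : ℕ, ∀ (M : ModuleCat R) (i : ℕ), n < i →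
    IsZero (((Ext R (ModuleCat R) i).obj (Opposite.op M)).obj (ModuleCat.of R R))

/-- A Gorenstein local ring: a noetherian local ring of finite self-injective dimension. -/
def IsGorensteinLocalRing (R : Type) [CommRing R] : Prop :=
  IsNoetherianRing R ∧ IsLocalRing R ∧ HasFiniteSelfInjDim R

/-- A commutative ring is generically Gorenstein if its localization at every
associated prime is a Gorenstein (local) ring. -/
def IsGenericallyGorenstein (R : Type) [CommRing R] : Prop :=
  ∀ (p : Ideal R) (hp : p.IsPrime), p ∈ associatedPrimes R R →
    IsGorensteinLocalRing (@Localization.AtPrime R _ p hp)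

open MonoidalCategory in
instance curriedTensorAdditive (R : Type) [CommRing R] :
    (curriedTensor (ModuleCat R)).Additive where
  map_add := by
    intros
    ext Z
    simp [MonoidalPreadditive.add_whiskerRight]

open MonoidalCategory in
instance curriedTensorObjAdditive (R : Type) [CommRing R] (X : ModuleCat R) :
    ((curriedTensor (ModuleCat R)).obj X).Additive where
  map_add := by
    intros
    simp [MonoidalPreadditive.whiskerLeft_add]

/-- The length of a module, i.e. the Krull dimension of its lattice of submodules.
For a module annihilated by the maximal ideal of a local ring `R` with residue field `k`,
this is `rank_k`. -/
def modLength (R M : Type) [CommRing R] [AddCommGroup M] [Module R M] : WithBot ℕ∞ :=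
  Order.krullDim (Submodule R M)

/-- A complex has finite homology: bounded and degreewise finitely generated homology. -/
def HasFiniteHomology (R : Type) [CommRing R] (M : Cx R) : Prop :=
  (∀ n : ℤ, Module.Finite R (M.homology n)) ∧
  (∃ a b : ℤ, ∀ n : ℤ, (n < a ∨ b < n) → IsZero (M.homology n))

/-- `p` is the coefficient function of the Poincaré series `P^R_M(t)`:
`p i = rank_k Tor^R_i(M, k)`, where `Tor^R_i(M, k)` is computed as the `(-i)`-th
cohomology of `F ⊗ k` for a semiprojective resolution `F` of `M`. -/
def IsPoincareCoeffs (R : Type) [CommRing R] [IsLocalRing R] (M : Cx R) (p : ℤ → ℕ) :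
    Prop :=
  ∀ (F : Cx R) (π : F ⟶ M), IsSemiprojResolution π → ∀ i : ℤ,
    modLength R ↥((HomologicalComplex.tensorObj F
        (sgl (ModuleCat.of R (R ⧸ IsLocalRing.maximalIdeal R)))).homology (-i)) =
      ((p i : ℕ∞) : WithBot ℕ∞)

/-- `q` is the coefficient function of the Bass series `I_R^M(t)`:
`q i = rank_k Ext_R^i(k, M)`, computed via a semiprojective resolution of `k`. -/
def IsBassCoeffs (R : Type) [CommRing R] [IsLocalRing R] (M : Cx R) (q : ℤ → ℕ) : Prop :=
  ∀ (F : Cx R) (π : F ⟶ sgl (ModuleCat.of R (R ⧸ IsLocalRing.maximalIdeal R))),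
    IsSemiprojResolution π → ∀ i : ℤ,
      modLength R (extModule R F M i) = ((q i : ℕ∞) : WithBot ℕ∞)

/-- The `i`-th coefficient of `c(t) · Σ p_j t^j` for a polynomial `c` and a Laurent
series with coefficients `p`. -/
def convCoeff (c : Polynomial ℤ) (p : ℤ → ℕ) (i : ℤ) : ℤ :=
  ∑ j ∈ c.support, c.coeff j * (p (i - (j : ℤ)) : ℤ)

section Elements

variable {R : Type} [CommRing R]

lemma Cx.d_d_apply (K : Cx R) (i j k : ℤ) (x : K.X i) : K.d j k (K.d i j x) = 0 := by
  rw [← ConcreteCategory.comp_apply, K.d_comp_d]; rfl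

lemma Cx.comm_apply {K L : Cx R} (f : K ⟶ L) (i j : ℤ) (x : K.X i) :
    L.d i j (f.f i x) = f.f j (K.d i j x) := by
  rw [← ConcreteCategory.comp_apply, f.comm, ConcreteCategory.comp_apply]

/-- The cohomology class of a cocycle. -/
def Cx.cls (K : Cx R) (n : ℤ) : LinearMap.ker (K.d n (n + 1)).hom →ₗ[R] K.homology n :=
  (K.liftCycles (ModuleCat.ofHom (LinearMap.ker (K.d n (n + 1)).hom).subtype) (n + 1) (by simp)
    (by ext x; exact x.2) ≫ K.homologyπ n).hom

lemma Cx.cls_surjective (K : Cx R) (n : ℤ) : Function.Surjective (K.cls n) := by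
  intro y
  obtain ⟨z, rfl⟩ := (ModuleCat.epi_iff_surjective (K.homologyπ n)).1 inferInstance y
  have hz : K.d n (n + 1) (K.iCycles n z) = 0 := by
    rw [← ConcreteCategory.comp_apply, K.iCycles_d]; rfl
  refine ⟨⟨K.iCycles n z, hz⟩, ?_⟩
  refine congrArg (K.homologyπ n) ?_
  apply (ModuleCat.mono_iff_injective (K.iCycles n)).1 inferInstance
  erw [← ConcreteCategory.comp_apply, K.liftCycles_i]
  rfl

lemma Cx.cls_eq_zero_iff (K : Cx R) (n : ℤ) (x : LinearMap.ker (K.d n (n + 1)).hom) :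
    K.cls n x = 0 ↔ ∃ y : K.X (n - 1), K.d (n - 1) n y = x.1 := by
  have hi : ∀ x, K.iCycles n (K.liftCycles
      (ModuleCat.ofHom (LinearMap.ker (K.d n (n + 1)).hom).subtype) (n + 1) (by simp)
      (by ext x; exact x.2) x) = x.1 := by
    intro x
    erw [← ConcreteCategory.comp_apply, K.liftCycles_i]
    rfl
  have hex : (ShortComplex.mk (K.toCycles (n - 1) n) (K.homologyπ n) (by simp)).Exact :=
    ShortComplex.exact_of_g_is_cokernel _ (K.homologyIsCokernel (n - 1) n (by simp))
  rw [ShortComplex.moduleCat_exact_iff] at hex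
  constructor
  · intro h
    obtain ⟨y, hy⟩ := hex _ h
    refine ⟨y, Eq.trans ?_ ((congrArg (K.iCycles n) hy).trans (hi x))⟩
    erw [← ConcreteCategory.comp_apply, K.toCycles_i]
  · rintro ⟨y, hy⟩
    have : K.liftCycles
      (ModuleCat.ofHom (LinearMap.ker (K.d n (n + 1)).hom).subtype) (n + 1) (by simp)
      (by ext x; exact x.2) x = K.toCycles (n - 1) n y := by
      apply (ModuleCat.mono_iff_injective (K.iCycles n)).1 inferInstance
      rw [hi, ← hy]
      erw [← ConcreteCategory.comp_apply, K.toCycles_i]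
    erw [ModuleCat.comp_apply, this, ← ConcreteCategory.comp_apply, K.toCycles_comp_homologyπ]
    rfl

lemma Cx.homologyMap_cls {K L : Cx R} (f : K ⟶ L) (n : ℤ)
    (x : LinearMap.ker (K.d n (n + 1)).hom) (y : LinearMap.ker (L.d n (n + 1)).hom)
    (h : f.f n x.1 = y.1) :
    HomologicalComplex.homologyMap f n (K.cls n x) = L.cls n y := by
  unfold Cx.cls
  erw [← ConcreteCategory.comp_apply]
  rw [Category.assoc, HomologicalComplex.homologyπ_naturality]
  erw [← Category.assoc, ModuleCat.comp_apply, ModuleCat.comp_apply]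
  refine congrArg (L.homologyπ n) ?_
  apply (ModuleCat.mono_iff_injective (L.iCycles n)).1 inferInstance
  erw [← ConcreteCategory.comp_apply, ← ConcreteCategory.comp_apply, L.liftCycles_i]
  rw [HomologicalComplex.liftCycles_comp_cyclesMap, HomologicalComplex.liftCycles_i]
  exact h

lemma Cx.isZero_homology_iff (K : Cx R) (n : ℤ) :
    IsZero (K.homology n) ↔
      ∀ x : K.X n, K.d n (n + 1) x = 0 → ∃ y : K.X (n - 1), K.d (n - 1) n y = x := by
  rw [ModuleCat.isZero_iff_subsingleton]
  constructor
  · intro h x hx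
    exact (K.cls_eq_zero_iff n ⟨x, hx⟩).1 (Subsingleton.elim _ _)
  · intro h
    refine subsingleton_of_forall_eq 0 fun y => ?_
    obtain ⟨x, rfl⟩ := K.cls_surjective n y
    exact (K.cls_eq_zero_iff n x).2 (h x.1 x.2)

/-- Cohomology as cocycles modulo coboundaries. -/
def Cx.homologyEquiv (K : Cx R) (n : ℤ) :
    (↥(LinearMap.ker (K.d n (n + 1)).hom) ⧸
      (Submodule.comap (LinearMap.ker (K.d n (n + 1)).hom).subtype
        (LinearMap.range (K.d (n - 1) n).hom))) ≃ₗ[R] K.homology n :=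
  (Submodule.quotEquivOfEq _ _ (by
    ext x
    rw [LinearMap.mem_ker, K.cls_eq_zero_iff]
    rfl)).trans ((K.cls n).quotKerEquivOfSurjective (K.cls_surjective n))

lemma Cx.quasiIsoAt_iff_bijective {K L : Cx R} (f : K ⟶ L) (n : ℤ) :
    QuasiIsoAt f n ↔ Function.Bijective (HomologicalComplex.homologyMap f n) := by
  rw [quasiIsoAt_iff_isIso_homologyMap, ConcreteCategory.isIso_iff_bijective]

lemma Cx.injective_homologyMap_iff {K L : Cx R} (f : K ⟶ L) (n : ℤ) :
    Function.Injective (HomologicalComplex.homologyMap f n) ↔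
      ∀ (x : K.X n) (y : L.X (n - 1)), K.d n (n + 1) x = 0 → L.d (n - 1) n y = f.f n x →
        ∃ z : K.X (n - 1), K.d (n - 1) n z = x := by
  rw [injective_iff_map_eq_zero]
  constructor
  · intro h x y hx hy
    have hfx : L.d n (n + 1) (f.f n x) = 0 := by rw [Cx.comm_apply, hx, map_zero]
    refine (K.cls_eq_zero_iff n ⟨x, hx⟩).1 (h _ ?_)
    rw [Cx.homologyMap_cls f n ⟨x, hx⟩ ⟨f.f n x, hfx⟩ rfl]
    exact (L.cls_eq_zero_iff n _).2 ⟨y, hy⟩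
  · intro h x hx
    obtain ⟨x, rfl⟩ := K.cls_surjective n x
    have hfx : L.d n (n + 1) (f.f n x.1) = 0 := by
      rw [Cx.comm_apply]; erw [x.2]; rw [map_zero]
    rw [Cx.homologyMap_cls f n x ⟨f.f n x.1, hfx⟩ rfl] at hx
    obtain ⟨y, hy⟩ := (L.cls_eq_zero_iff n _).1 hx
    exact (K.cls_eq_zero_iff n _).2 (h x.1 y x.2 hy)

lemma Cx.surjective_homologyMap_iff {K L : Cx R} (f : K ⟶ L) (n : ℤ) :
    Function.Surjective (HomologicalComplex.homologyMap f n) ↔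
      ∀ y : L.X n, L.d n (n + 1) y = 0 → ∃ (x : K.X n) (w : L.X (n - 1)),
        K.d n (n + 1) x = 0 ∧ y = f.f n x + L.d (n - 1) n w := by
  constructor
  · intro h y hy
    obtain ⟨x, hx⟩ := h (L.cls n ⟨y, hy⟩)
    obtain ⟨x, rfl⟩ := K.cls_surjective n x
    have hfx : L.d n (n + 1) (f.f n x.1) = 0 := by
      rw [Cx.comm_apply]; erw [x.2]; rw [map_zero]
    rw [Cx.homologyMap_cls f n x ⟨f.f n x.1, hfx⟩ rfl, eq_comm, ← sub_eq_zero, ← map_sub,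
      Cx.cls_eq_zero_iff] at hx
    obtain ⟨w, hw⟩ := hx
    exact ⟨x.1, w, x.2, by rw [hw]; simp⟩
  · intro h y
    obtain ⟨y, rfl⟩ := L.cls_surjective n y
    obtain ⟨x, w, hx, hw⟩ := h y.1 y.2
    have hfx : L.d n (n + 1) (f.f n x) = 0 := by rw [Cx.comm_apply, hx, map_zero]
    refine ⟨K.cls n ⟨x, hx⟩, ?_⟩
    rw [Cx.homologyMap_cls f n ⟨x, hx⟩ ⟨f.f n x, hfx⟩ rfl, eq_comm, ← sub_eq_zero, ← map_sub,
      Cx.cls_eq_zero_iff]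
    exact ⟨w, by simp [hw]⟩

lemma Cx.quasiIso_iff_elements {K L : Cx R} (f : K ⟶ L) :
    QuasiIso f ↔ ∀ n : ℤ,
      (∀ (x : K.X n) (y : L.X (n - 1)), K.d n (n + 1) x = 0 → L.d (n - 1) n y = f.f n x →
        ∃ z : K.X (n - 1), K.d (n - 1) n z = x) ∧
      (∀ y : L.X n, L.d n (n + 1) y = 0 → ∃ (x : K.X n) (w : L.X (n - 1)),
        K.d n (n + 1) x = 0 ∧ y = f.f n x + L.d (n - 1) n w) := by
  rw [quasiIso_iff]
  refine forall_congr' fun n => ?_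
  rw [Cx.quasiIsoAt_iff_bijective, Function.Bijective, Cx.injective_homologyMap_iff,
    Cx.surjective_homologyMap_iff]

end Elements

section HomCx

variable {R : Type} [CommRing R]

/-- The complex of homomorphisms between two complexes of modules. -/
def homCx (A B : Cx R) : Cx R where
  X n := ModuleCat.of R (Cochain A B n)
  d i j := ModuleCat.ofHom (δ_hom R A B i j)
  shape i j h := ModuleCat.hom_ext (LinearMap.ext fun z => δ_shape i j h z)
  d_comp_d' i j k _ _ := ModuleCat.hom_ext (LinearMap.ext fun z => δ_δ i j k z)

/-- View an element of the Hom complex as a cochain. -/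
abbrev homCx.toCochain {A B : Cx R} {n : ℤ} (z : (homCx A B).X n) : Cochain A B n := z

/-- Precomposition on Hom complexes. -/
def homCx.mapL {A A' : Cx R} (f : A ⟶ A') (B : Cx R) : homCx A' B ⟶ homCx A B where
  f n := ModuleCat.ofHom
    { toFun := fun z : Cochain A' B n => (Cochain.ofHom f).comp z (zero_add n)
      map_add' := fun _ _ => Cochain.comp_add _ _ _ _
      map_smul' := fun _ _ => Cochain.comp_smul _ _ _ _ }
  comm' _ j _ := ModuleCat.hom_ext (LinearMap.ext fun z => δ_ofHom_comp f z j)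

/-- Postcomposition on Hom complexes. -/
def homCx.mapR (A : Cx R) {B B' : Cx R} (g : B ⟶ B') : homCx A B ⟶ homCx A B' where
  f n := ModuleCat.ofHom
    { toFun := fun z : Cochain A B n => z.comp (Cochain.ofHom g) (add_zero n)
      map_add' := fun _ _ => Cochain.add_comp _ _ _ _
      map_smul' := fun _ _ => Cochain.smul_comp _ _ _ _ }
  comm' _ j _ := ModuleCat.hom_ext (LinearMap.ext fun z => δ_comp_ofHom z g j)

/-- The cohomology of the Hom complex. -/
def homCx.extEquiv (A B : Cx R) (n : ℤ) : extModule R A B n ≃ₗ[R] (homCx A B).homology n :=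
  (homCx A B).homologyEquiv n

lemma homCx.mapR_comp (A : Cx R) {B B' B'' : Cx R} (g : B ⟶ B') (g' : B' ⟶ B'') :
    homCx.mapR A (g ≫ g') = homCx.mapR A g ≫ homCx.mapR A g' := by
  ext n z
  refine Cochain.ext _ _ fun p q hpq => ?_
  change (Cochain.comp (homCx.toCochain z) (Cochain.ofHom (g ≫ g')) (add_zero n)).v p q hpq =
    (Cochain.comp (Cochain.comp (homCx.toCochain z) (Cochain.ofHom g) (add_zero n))
      (Cochain.ofHom g') (add_zero n)).v p q hpq
  simp

lemma homCx.mapL_comp {A A' A'' : Cx R} (f : A ⟶ A') (f' : A' ⟶ A'') (B : Cx R) :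
    homCx.mapL (f ≫ f') B = homCx.mapL f' B ≫ homCx.mapL f B := by
  ext n z
  refine Cochain.ext _ _ fun p q hpq => ?_
  change (Cochain.comp (Cochain.ofHom (f ≫ f')) (homCx.toCochain z) (zero_add n)).v p q hpq =
    (Cochain.comp (Cochain.ofHom f) (Cochain.comp (Cochain.ofHom f') (homCx.toCochain z)
      (zero_add n)) (zero_add n)).v p q hpq
  simp

lemma cocycle_toHom_precomp {A A' B : Cx R} (f : A ⟶ A') {n : ℤ} (z : Cocycle A' B n) :
    CohomologyClass.toHom (CohomologyClass.mk (z.precomp f)) =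
      (HomotopyCategory.quotient _ _).map f ≫
        CohomologyClass.toHom (CohomologyClass.mk z) := by
  rw [CohomologyClass.toHom_mk, CohomologyClass.toHom_mk, Cocycle.equivHomShift_symm_precomp,
    Functor.map_comp]

lemma cocycle_toHom_postcomp {A B B' : Cx R} (g : B ⟶ B') {n : ℤ} (z : Cocycle A B n) :
    CohomologyClass.toHom (CohomologyClass.mk (z.postcomp g)) =
        CohomologyClass.toHom (CohomologyClass.mk z) ≫
          (HomotopyCategory.quotient _ _).map (g⟦n⟧') := by
  rw [CohomologyClass.toHom_mk, CohomologyClass.toHom_mk, Cocycle.equivHomShift_symm_postcomp,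
    Functor.map_comp]

lemma mk_eq_mk_iff_exists {A B : Cx R} {n : ℤ} (z w : Cocycle A B n) :
    CohomologyClass.mk z = CohomologyClass.mk w ↔
      ∃ b : Cochain A B (n - 1), δ (n - 1) n b = z.1 - w.1 := by
  rw [← sub_eq_zero, ← CohomologyClass.mk_sub, CohomologyClass.mk_eq_zero_iff,
    mem_coboundaries_iff _ (n - 1) (by simp)]
  rfl

lemma quotient_precomp_bijective {A A' B : Cx R} (f : A ⟶ A') [QuasiIso f] [B.IsKInjective] :
    Function.Bijective (fun g : (HomotopyCategory.quotient _ _).obj A' ⟶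
      (HomotopyCategory.quotient _ _).obj B => (HomotopyCategory.quotient _ _).map f ≫ g) := by
  let _ := HasDerivedCategory.standard (ModuleCat R)
  have hA := CochainComplex.IsKInjective.Qh_map_bijective
    ((HomotopyCategory.quotient _ _).obj A) B
  have hA' := CochainComplex.IsKInjective.Qh_map_bijective
    ((HomotopyCategory.quotient _ _).obj A') B
  have : IsIso (DerivedCategory.Qh.map ((HomotopyCategory.quotient _ _).map f)) := by
    change IsIso (DerivedCategory.Q.map f)
    rw [DerivedCategory.isIso_Q_map_iff_quasiIso]
    infer_instance
  rw [← Function.Bijective.of_comp_iff' hA]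
  have : (DerivedCategory.Qh.map ∘ fun g : (HomotopyCategory.quotient _ _).obj A' ⟶
      (HomotopyCategory.quotient _ _).obj B => (HomotopyCategory.quotient _ _).map f ≫ g) =
      (fun g => DerivedCategory.Qh.map ((HomotopyCategory.quotient _ _).map f) ≫ g) ∘
      DerivedCategory.Qh.map := by
    ext g
    simp
  rw [this]
  refine Function.Bijective.comp ?_ hA'
  exact ⟨fun a b h => (cancel_epi _).1 h, fun g => ⟨inv (DerivedCategory.Qh.map
    ((HomotopyCategory.quotient _ _).map f)) ≫ g, by simp⟩⟩

lemma quotient_postcomp_bijective {A B B' : Cx R} (f : B ⟶ B') [QuasiIso f] [A.IsKProjective] :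
    Function.Bijective (fun g : (HomotopyCategory.quotient _ _).obj A ⟶
      (HomotopyCategory.quotient _ _).obj B => g ≫ (HomotopyCategory.quotient _ _).map f) := by
  let _ := HasDerivedCategory.standard (ModuleCat R)
  have hA := CochainComplex.IsKProjective.Qh_map_bijective A
    ((HomotopyCategory.quotient _ _).obj B)
  have hA' := CochainComplex.IsKProjective.Qh_map_bijective A
    ((HomotopyCategory.quotient _ _).obj B')
  have : IsIso (DerivedCategory.Qh.map ((HomotopyCategory.quotient _ _).map f)) := by
    change IsIso (DerivedCategory.Q.map f)
    rw [DerivedCategory.isIso_Q_map_iff_quasiIso]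
    infer_instance
  rw [← Function.Bijective.of_comp_iff' hA']
  have : (DerivedCategory.Qh.map ∘ fun g : (HomotopyCategory.quotient _ _).obj A ⟶
      (HomotopyCategory.quotient _ _).obj B => g ≫ (HomotopyCategory.quotient _ _).map f) =
      (fun g => g ≫ DerivedCategory.Qh.map ((HomotopyCategory.quotient _ _).map f)) ∘
      DerivedCategory.Qh.map := by
    ext g
    simp
  rw [this]
  refine Function.Bijective.comp ?_ hA
  exact ⟨fun a b h => (cancel_mono _).1 h, fun g => ⟨g ≫ inv (DerivedCategory.Qh.map
    ((HomotopyCategory.quotient _ _).map f)), by simp⟩⟩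

lemma homCx.quasiIso_mapL {A A' : Cx R} (f : A ⟶ A') [QuasiIso f] (B : Cx R) [B.IsKInjective] :
    QuasiIso (homCx.mapL f B) := by
  rw [Cx.quasiIso_iff_elements]
  intro n
  have hb := quotient_precomp_bijective (B := B⟦n⟧) f
  constructor
  · intro x y hx hy
    let z : Cocycle A' B n := Cocycle.mk x (n + 1) rfl hx
    have h1 : CohomologyClass.mk (z.precomp f) = 0 := by
      rw [← CohomologyClass.mk_zero, mk_eq_mk_iff_exists]
      exact ⟨y, hy.trans (sub_zero _).symm⟩
    have h2 := cocycle_toHom_precomp f z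
    rw [h1, map_zero] at h2
    have h3 : CohomologyClass.toHom (CohomologyClass.mk z) = 0 :=
      hb.1 (h2.symm.trans comp_zero.symm)
    rw [CohomologyClass.toHom_mk_eq_zero_iff, mem_coboundaries_iff _ (n - 1) (by simp)] at h3
    exact h3
  · intro y hy
    let z : Cocycle A B n := Cocycle.mk y (n + 1) rfl hy
    obtain ⟨g, hg⟩ := hb.2 (CohomologyClass.toHom (CohomologyClass.mk z))
    obtain ⟨c, rfl⟩ := (CohomologyClass.toHom_bijective _ _ _).2 g
    obtain ⟨w, rfl⟩ := c.mk_surjective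
    dsimp only at hg
    rw [← cocycle_toHom_precomp] at hg
    have := (CohomologyClass.toHom_bijective _ _ _).1 hg
    rw [eq_comm, mk_eq_mk_iff_exists] at this
    obtain ⟨b, hb⟩ := this
    refine ⟨w.1, b, w.δ_eq_zero (n + 1), ?_⟩
    change z.1 = (w.precomp f).1 + δ (n - 1) n b
    rw [hb]
    abel

lemma homCx.quasiIso_mapR (A : Cx R) [A.IsKProjective] {B B' : Cx R} (f : B ⟶ B') [QuasiIso f] :
    QuasiIso (homCx.mapR A f) := by
  rw [Cx.quasiIso_iff_elements]
  intro n
  have : QuasiIso (f⟦n⟧') := by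
    let _ := HasDerivedCategory.standard (ModuleCat R)
    rw [← DerivedCategory.isIso_Q_map_iff_quasiIso]
    have : IsIso (DerivedCategory.Q.map f) := by
      rw [DerivedCategory.isIso_Q_map_iff_quasiIso]
      infer_instance
    have e := (NatIso.naturality_2 (DerivedCategory.Q.commShiftIso n) f).symm
    dsimp at e
    rw [e]
    infer_instance
  have hb := quotient_postcomp_bijective (A := A) (f⟦n⟧')
  constructor
  · intro x y hx hy
    let z : Cocycle A B n := Cocycle.mk x (n + 1) rfl hx
    have h1 : CohomologyClass.mk (z.postcomp f) = 0 := by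
      rw [← CohomologyClass.mk_zero, mk_eq_mk_iff_exists]
      exact ⟨y, hy.trans (sub_zero _).symm⟩
    have h2 := cocycle_toHom_postcomp f z
    rw [h1, map_zero] at h2
    have h3 : CohomologyClass.toHom (CohomologyClass.mk z) = 0 :=
      hb.1 (h2.symm.trans zero_comp.symm)
    rw [CohomologyClass.toHom_mk_eq_zero_iff, mem_coboundaries_iff _ (n - 1) (by simp)] at h3
    exact h3
  · intro y hy
    let z : Cocycle A B' n := Cocycle.mk y (n + 1) rfl hy
    obtain ⟨g, hg⟩ := hb.2 (CohomologyClass.toHom (CohomologyClass.mk z))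
    obtain ⟨c, rfl⟩ := (CohomologyClass.toHom_bijective _ _ _).2 g
    obtain ⟨w, rfl⟩ := c.mk_surjective
    dsimp only at hg
    rw [← cocycle_toHom_postcomp] at hg
    have := (CohomologyClass.toHom_bijective _ _ _).1 hg
    rw [eq_comm, mk_eq_mk_iff_exists] at this
    obtain ⟨b, hb⟩ := this
    refine ⟨w.1, b, w.δ_eq_zero (n + 1), ?_⟩
    change z.1 = (w.postcomp f).1 + δ (n - 1) n b
    rw [hb]
    abel

end HomCx

section HomCxExact

variable {R : Type} [CommRing R]

lemma shortExact_of_elements {R : Type} [CommRing R] {X Y Z : ModuleCat R} (f : X ⟶ Y) (g : Y ⟶ Z)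
    (w : f ≫ g = 0) (hf : Function.Injective f) (hex : ∀ y : Y, g y = 0 → ∃ x : X, f x = y)
    (hg : Function.Surjective g) : (ShortComplex.mk f g w).ShortExact where
  exact := (ShortComplex.moduleCat_exact_iff _).2 hex
  mono_f := (ModuleCat.mono_iff_injective f).2 hf
  epi_g := (ModuleCat.epi_iff_surjective g).2 hg

/-- The image of a short complex of complexes under `Hom(K, -)`. -/
def homCx.shortComplexR (K : Cx R) (S : ShortComplex (Cx R)) : ShortComplex (Cx R) :=
  ShortComplex.mk (homCx.mapR K S.f) (homCx.mapR K S.g) (by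
    rw [← homCx.mapR_comp, S.zero]
    ext n z
    refine Cochain.ext _ _ fun p q hpq => ?_
    change (Cochain.comp (homCx.toCochain z) (Cochain.ofHom 0) (add_zero n)).v p q hpq = 0
    simp)

/-- The image of a short complex of complexes under `Hom(-, I)`. -/
def homCx.shortComplexL (I : Cx R) (S : ShortComplex (Cx R)) : ShortComplex (Cx R) :=
  ShortComplex.mk (homCx.mapL S.g I) (homCx.mapL S.f I) (by
    rw [← homCx.mapL_comp, S.zero]
    ext n z
    refine Cochain.ext _ _ fun p q hpq => ?_
    change (Cochain.comp (Cochain.ofHom 0) (homCx.toCochain z) (zero_add n)).v p q hpq = 0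
    simp)

lemma Cochain.eq_zero_of_comp_ofHom_eq_zero {K A B : Cx R} {n : ℤ} (z : Cochain K A n) (f : A ⟶ B)
    (hf : ∀ q, Mono (f.f q)) (hz : z.comp (Cochain.ofHom f) (add_zero n) = 0) : z = 0 := by
  refine Cochain.ext _ _ fun p q hpq => ?_
  have hz' := Cochain.congr_v hz p q hpq
  simp only [Cochain.comp_zero_cochain_v, Cochain.ofHom_v, Cochain.zero_v] at hz'
  exact (cancel_mono (f.f q)).1 (hz'.trans zero_comp.symm)

lemma Cochain.eq_zero_of_ofHom_comp_eq_zero {K A B : Cx R} {n : ℤ} (z : Cochain B K n) (f : A ⟶ B)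
    (hf : ∀ q, Epi (f.f q)) (hz : (Cochain.ofHom f).comp z (zero_add n) = 0) : z = 0 := by
  refine Cochain.ext _ _ fun p q hpq => ?_
  have hz' := Cochain.congr_v hz p q hpq
  simp only [Cochain.zero_cochain_comp_v, Cochain.ofHom_v, Cochain.zero_v] at hz'
  exact (cancel_epi (f.f p)).1 (hz'.trans comp_zero.symm)

lemma Cochain.exists_comp_ofHom_eq {K A B : Cx R} {n : ℤ} (z : Cochain K B n) (f : A ⟶ B)
    (h : ∀ p q hpq, ∃ w, w ≫ f.f q = z.v p q hpq) :
    ∃ w : Cochain K A n, w.comp (Cochain.ofHom f) (add_zero n) = z := by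
  choose w hw using h
  refine ⟨Cochain.mk w, Cochain.ext _ _ fun p q hpq => ?_⟩
  simp [hw]

lemma Cochain.exists_ofHom_comp_eq {K A B : Cx R} {n : ℤ} (z : Cochain A K n) (f : A ⟶ B)
    (h : ∀ p q hpq, ∃ w, f.f p ≫ w = z.v p q hpq) :
    ∃ w : Cochain B K n, (Cochain.ofHom f).comp w (zero_add n) = z := by
  choose w hw using h
  refine ⟨Cochain.mk w, Cochain.ext _ _ fun p q hpq => ?_⟩
  simp [hw]

lemma homCx.shortExact_R (K : Cx R) [∀ n, Projective (K.X n)] {S : ShortComplex (Cx R)}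
    (hS : S.ShortExact) : (homCx.shortComplexR K S).ShortExact := by
  have hd : ∀ q, (S.map (HomologicalComplex.eval _ _ q)).ShortExact :=
    fun q => hS.map_of_exact _
  have hm : ∀ q, Mono (S.f.f q) := fun q => (hd q).mono_f
  have he : ∀ q, Epi (S.g.f q) := fun q => (hd q).epi_g
  refine HomologicalComplex.shortExact_of_degreewise_shortExact _ fun n => ?_
  refine shortExact_of_elements _ _ _ ?_ ?_ ?_
  · rw [injective_iff_map_eq_zero]
    exact fun z hz => Cochain.eq_zero_of_comp_ofHom_eq_zero z S.f hm hz
  · intro z hz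
    refine Cochain.exists_comp_ofHom_eq z S.f fun p q hpq => ?_
    have h := (Cochain.comp_zero_cochain_v _ _ _ _ _).symm.trans (Cochain.congr_v hz p q hpq)
    rw [Cochain.ofHom_v] at h
    have := (hd q).mono_f
    exact ⟨_, (hd q).exact.lift_f _ h⟩
  · intro z
    exact Cochain.exists_comp_ofHom_eq z S.g fun p q hpq => ⟨_, Projective.factorThru_comp _ _⟩

lemma homCx.shortExact_L (I : Cx R) [∀ n, Injective (I.X n)] {S : ShortComplex (Cx R)}
    (hS : S.ShortExact) : (homCx.shortComplexL I S).ShortExact := by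
  have hd : ∀ q, (S.map (HomologicalComplex.eval _ _ q)).ShortExact :=
    fun q => hS.map_of_exact _
  have hm : ∀ q, Mono (S.f.f q) := fun q => (hd q).mono_f
  have he : ∀ q, Epi (S.g.f q) := fun q => (hd q).epi_g
  refine HomologicalComplex.shortExact_of_degreewise_shortExact _ fun n => ?_
  refine shortExact_of_elements _ _ _ ?_ ?_ ?_
  · rw [injective_iff_map_eq_zero]
    exact fun z hz => Cochain.eq_zero_of_ofHom_comp_eq_zero z S.g he hz
  · intro z hz
    refine Cochain.exists_ofHom_comp_eq z S.g fun p q hpq => ?_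
    have h := (Cochain.zero_cochain_comp_v _ _ _ _ _).symm.trans (Cochain.congr_v hz p q hpq)
    rw [Cochain.ofHom_v] at h
    have := (hd p).epi_g
    exact ⟨_, (hd p).exact.g_desc _ h⟩
  · intro z
    exact Cochain.exists_ofHom_comp_eq z S.f fun p q hpq => ⟨_, Injective.comp_factorThru _ _⟩

end HomCxExact

section LES

variable {R : Type} [CommRing R]

lemma les_exact₂ {S : ShortComplex (Cx R)} (hS : S.ShortExact) (n : ℤ) :
    Function.Exact (HomologicalComplex.homologyMap S.f n)
      (HomologicalComplex.homologyMap S.g n) :=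
  (ShortComplex.ShortExact.moduleCat_exact_iff_function_exact _).1 (hS.homology_exact₂ n)

lemma les_exact₃ {S : ShortComplex (Cx R)} (hS : S.ShortExact) (n : ℤ) :
    Function.Exact (HomologicalComplex.homologyMap S.g n) (hS.δ n (n + 1) rfl) :=
  (ShortComplex.ShortExact.moduleCat_exact_iff_function_exact _).1
    (hS.homology_exact₃ n (n + 1) rfl)

lemma les_exact₁ {S : ShortComplex (Cx R)} (hS : S.ShortExact) (n : ℤ) :
    Function.Exact (hS.δ n (n + 1) rfl) (HomologicalComplex.homologyMap S.f (n + 1)) :=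
  (ShortComplex.ShortExact.moduleCat_exact_iff_function_exact _).1
    (hS.homology_exact₁ n (n + 1) rfl)

lemma quasiIso_middle {S T : ShortComplex (Cx R)} (φ : S ⟶ T) (hS : S.ShortExact)
    (hT : T.ShortExact) (h₁ : QuasiIso φ.τ₁) (h₃ : QuasiIso φ.τ₃) : QuasiIso φ.τ₂ := by
  rw [quasiIso_iff] at h₁ h₃ ⊢
  simp only [Cx.quasiIsoAt_iff_bijective] at h₁ h₃ ⊢
  intro n
  obtain ⟨n, rfl⟩ : ∃ m, n = m + 1 := ⟨n - 1, by simp⟩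
  have comm : ∀ {A B C D : ModuleCat R} {f : A ⟶ B} {g : B ⟶ D} {f' : A ⟶ C} {g' : C ⟶ D},
      f ≫ g = f' ≫ g' → g.hom.comp f.hom = g'.hom.comp f'.hom := fun h => by
    rw [← ModuleCat.hom_comp, h, ModuleCat.hom_comp]
  exact LinearMap.bijective_of_surjective_of_bijective_of_bijective_of_injective
    (hS.δ n (n + 1) rfl).hom (HomologicalComplex.homologyMap S.f (n + 1)).hom
    (HomologicalComplex.homologyMap S.g (n + 1)).hom (hS.δ (n + 1) (n + 1 + 1) rfl).hom
    (hT.δ n (n + 1) rfl).hom (HomologicalComplex.homologyMap T.f (n + 1)).hom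
    (HomologicalComplex.homologyMap T.g (n + 1)).hom (hT.δ (n + 1) (n + 1 + 1) rfl).hom
    (HomologicalComplex.homologyMap φ.τ₃ n).hom (HomologicalComplex.homologyMap φ.τ₁ (n + 1)).hom
    (HomologicalComplex.homologyMap φ.τ₂ (n + 1)).hom
    (HomologicalComplex.homologyMap φ.τ₃ (n + 1)).hom
    (HomologicalComplex.homologyMap φ.τ₁ (n + 1 + 1)).hom
    (comm (HomologicalComplex.HomologySequence.δ_naturality φ hS hT n (n + 1) rfl).symm)
    (comm (by rw [← HomologicalComplex.homologyMap_comp, ← HomologicalComplex.homologyMap_comp,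
      φ.comm₁₂]))
    (comm (by rw [← HomologicalComplex.homologyMap_comp, ← HomologicalComplex.homologyMap_comp,
      φ.comm₂₃]))
    (comm (HomologicalComplex.HomologySequence.δ_naturality φ hS hT (n + 1) (n + 1 + 1) rfl).symm)
    (les_exact₁ hS n) (les_exact₂ hS (n + 1)) (les_exact₃ hS (n + 1))
    (les_exact₁ hT n) (les_exact₂ hT (n + 1)) (les_exact₃ hT (n + 1))
    (h₃ n).2 (h₁ (n + 1)) (h₃ (n + 1)) (h₁ (n + 1 + 1)).1

end LES

section Devissage

variable {R : Type} [CommRing R]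

/-- The module `N` as a complex concentrated in degree `n`. -/
abbrev sg (n : ℤ) (N : ModuleCat R) : Cx R :=
  (HomologicalComplex.single (ModuleCat R) (ComplexShape.up ℤ) n).obj N

lemma finite_of_quasiIsoAt {X Y : Cx R} (f : X ⟶ Y) (n : ℤ) (hf : QuasiIsoAt f n) :
    Module.Finite R (X.homology n) ↔ Module.Finite R (Y.homology n) :=
  Module.Finite.equiv_iff (isoOfQuasiIsoAt f n).toLinearEquiv

lemma finite_of_isZero {X : ModuleCat R} (h : IsZero X) : Module.Finite R X := by
  rw [ModuleCat.isZero_iff_subsingleton] at h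
  infer_instance

lemma isZero_homology_iff_of_quasiIsoAt {X Y : Cx R} (f : X ⟶ Y) (n : ℤ) (hf : QuasiIsoAt f n) :
    IsZero (X.homology n) ↔ IsZero (Y.homology n) :=
  (isoOfQuasiIsoAt f n).isZero_iff

lemma complex_devissage_single (P : Cx R → Prop)
    (hq : ∀ {X Y : Cx R} (f : X ⟶ Y), QuasiIso f → (P X ↔ P Y))
    (hs : ∀ (n : ℤ) (N : ModuleCat R), Module.Finite R N → P (sg n N))
    (n : ℤ) (M : Cx R) [M.IsGE n] [M.IsLE n] (hf : ∀ i, Module.Finite R (M.homology i)) :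
    P M := by
  have h1 : QuasiIso (M.ιTruncLE n) := inferInstance
  have : (M.truncLE n).IsGE n := by
    rw [CochainComplex.isGE_iff]
    intro i hi
    rw [HomologicalComplex.exactAt_iff_isZero_homology]
    exact (isZero_homology_iff_of_quasiIsoAt (M.ιTruncLE n) i inferInstance).2
      (CochainComplex.isZero_of_isGE _ n i)
  have h2 : QuasiIso ((M.truncLE n).πTruncGE n) := inferInstance
  obtain ⟨A, ⟨e⟩⟩ := CochainComplex.exists_iso_single ((M.truncLE n).truncGE n) n
  have h3 : QuasiIso e.hom := inferInstance
  rw [← hq _ h1, hq _ h2, hq _ h3]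
  refine hs n A ?_
  have := (finite_of_quasiIsoAt (M.ιTruncLE n) n inferInstance).2 (hf n)
  have := (finite_of_quasiIsoAt ((M.truncLE n).πTruncGE n) n inferInstance).1 this
  have := (finite_of_quasiIsoAt e.hom n inferInstance).1 this
  exact (Module.Finite.equiv_iff
    (HomologicalComplex.singleObjHomologySelfIso _ n A).toLinearEquiv).1 this

/-- Properties of complexes with finite homology can be checked on finite modules. -/
lemma complex_devissage (P : Cx R → Prop)
    (hq : ∀ {X Y : Cx R} (f : X ⟶ Y), QuasiIso f → (P X ↔ P Y))
    (hext : ∀ {S : ShortComplex (Cx R)}, S.ShortExact → P S.X₁ → P S.X₃ → P S.X₂)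
    (hs : ∀ (n : ℤ) (N : ModuleCat R), Module.Finite R N → P (sg n N))
    (M : Cx R) (hM : HasFiniteHomology R M) : P M := by
  obtain ⟨hf, a, b, hab⟩ := hM
  suffices h : ∀ (k : ℕ) (M : Cx R), (∀ i, Module.Finite R (M.homology i)) → M.IsGE a →
      M.IsLE (a + k) → P M by
    refine h (b - a).toNat M hf ?_ ?_
    · rw [CochainComplex.isGE_iff]
      intro i hi
      rw [HomologicalComplex.exactAt_iff_isZero_homology]
      exact hab i (Or.inl hi)
    · rw [CochainComplex.isLE_iff]
      intro i hi
      rw [HomologicalComplex.exactAt_iff_isZero_homology]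
      exact hab i (by omega)
  intro k
  induction k with
  | zero =>
    intro M hf _ h
    simp only [Nat.cast_zero, add_zero] at h
    exact complex_devissage_single P hq hs a M hf
  | succ k ih =>
    intro M hf _ h
    push_cast at h
    rw [← add_assoc] at h
    refine hext (M.shortComplexTruncLE_shortExact (a + k)) ?_ ?_
    · refine ih _ ?_ ?_ ?_
      · intro i
        by_cases hi : i ≤ a + k
        · exact (finite_of_quasiIsoAt (M.ιTruncLE (a + k)) i
            (CochainComplex.quasiIsoAt_ιTruncLE _ _ _ hi)).2 (hf i)
        · exact finite_of_isZero ((M.truncLE (a + k)).isZero_of_isLE (a + k) i (by omega))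
      · rw [CochainComplex.isGE_iff]
        intro i hi
        rw [HomologicalComplex.exactAt_iff_isZero_homology]
        exact (isZero_homology_iff_of_quasiIsoAt (M.ιTruncLE (a + k)) i
          (CochainComplex.quasiIsoAt_ιTruncLE _ _ _ (by omega))).2
          (CochainComplex.isZero_of_isGE _ a i)
      · change (M.truncLE (a + k)).IsLE (a + k)
        infer_instance
    · have h1 : QuasiIso (M.shortComplexTruncLEX₃ToTruncGE (a + k) (a + k + 1)) := inferInstance
      rw [hq _ h1]
      have : (M.truncGE (a + k + 1)).IsLE (a + k + 1) := by
        rw [CochainComplex.isLE_iff]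
        intro i hi
        rw [HomologicalComplex.exactAt_iff_isZero_homology]
        exact (isZero_homology_iff_of_quasiIsoAt (M.πTruncGE (a + k + 1)) i
          (CochainComplex.quasiIsoAt_πTruncGE _ _ _ (by omega))).1
          (CochainComplex.isZero_of_isLE _ (a + k + 1) i)
      refine complex_devissage_single P hq hs (a + k + 1) _ ?_
      intro i
      by_cases hi : a + k + 1 ≤ i
      · exact (finite_of_quasiIsoAt (M.πTruncGE (a + k + 1)) i
          (CochainComplex.quasiIsoAt_πTruncGE _ _ _ hi)).1 (hf i)
      · exact finite_of_isZero (CochainComplex.isZero_of_isGE _ (a + k + 1) i (by omega))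

end Devissage

section LocalDevissage

variable {R : Type} [CommRing R]

lemma ModuleCat.shortExact_of_functions {A B C : Type} [AddCommGroup A] [Module R A]
    [AddCommGroup B] [Module R B] [AddCommGroup C] [Module R C] (f : A →ₗ[R] B) (g : B →ₗ[R] C)
    (hf : Function.Injective f) (hg : Function.Surjective g) (h : Function.Exact f g) :
    (ShortComplex.mk (ModuleCat.ofHom f) (ModuleCat.ofHom g)
      (ModuleCat.hom_ext (LinearMap.ext fun z => h.apply_apply_eq_zero z))).ShortExact where
  exact := by
    rw [ShortComplex.ShortExact.moduleCat_exact_iff_function_exact]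
    exact h
  mono_f := (ModuleCat.mono_iff_injective _).2 hf
  epi_g := (ModuleCat.epi_iff_surjective _).2 hg

lemma hasFiniteHomology_sg (n : ℤ) (N : ModuleCat R) (hN : Module.Finite R N) :
    HasFiniteHomology R (sg n N) := by
  have h0 : ∀ i, i ≠ n → IsZero ((sg n N).homology i) := fun i hi => by
    rw [← HomologicalComplex.exactAt_iff_isZero_homology]
    exact HomologicalComplex.exactAt_single_obj _ _ _ _ hi
  refine ⟨fun i => ?_, n, n, fun i hi => h0 i (by omega)⟩
  by_cases hi : i = n
  · subst hi
    exact (Module.Finite.equiv_iff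
      (HomologicalComplex.singleObjHomologySelfIso _ i N).toLinearEquiv).2 hN
  · exact finite_of_isZero (h0 i hi)


/-- The residue field of `R`, as an `R`-module. -/
abbrev resField (R : Type) [CommRing R] [IsLocalRing R] : ModuleCat R :=
  ModuleCat.of R (R ⧸ IsLocalRing.maximalIdeal R)

/-- The map `R ⧸ (a : x) → R ⧸ a` induced by multiplication by `x`. -/
def colonMul (a : Ideal R) (x : R) : (R ⧸ Submodule.comap (LinearMap.lsmul R R x) a) →ₗ[R] R ⧸ a :=
  Submodule.mapQ _ _ (LinearMap.lsmul R R x) le_rfl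

lemma colonMul_injective (a : Ideal R) (x : R) : Function.Injective (colonMul a x) := by
  rw [← LinearMap.ker_eq_bot, LinearMap.ker_eq_bot']
  intro z hz
  obtain ⟨r, rfl⟩ := Submodule.Quotient.mk_surjective _ z
  rw [colonMul, Submodule.mapQ_apply, Submodule.Quotient.mk_eq_zero] at hz
  rw [Submodule.Quotient.mk_eq_zero]
  exact hz

lemma colonMul_exact (a : Ideal R) (x : R) :
    Function.Exact (colonMul a x) (Submodule.factor (le_sup_left : a ≤ a ⊔ Ideal.span {x})) := by
  intro z
  obtain ⟨r, rfl⟩ := Submodule.Quotient.mk_surjective _ z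
  change (Submodule.Quotient.mk r : R ⧸ a ⊔ Ideal.span {x}) = 0 ↔ _
  rw [Submodule.Quotient.mk_eq_zero, Submodule.mem_sup]
  constructor
  · rintro ⟨y, hy, z, hz, rfl⟩
    obtain ⟨s, rfl⟩ := Ideal.mem_span_singleton'.1 hz
    refine ⟨Submodule.Quotient.mk s, ?_⟩
    rw [colonMul, Submodule.mapQ_apply, Submodule.Quotient.eq]
    have : (LinearMap.lsmul R R x) s - (y + s * x) = -y := by simp [mul_comm]
    rw [this]
    exact a.neg_mem hy
  · rintro ⟨w, hw⟩
    obtain ⟨s, rfl⟩ := Submodule.Quotient.mk_surjective _ w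
    rw [colonMul, Submodule.mapQ_apply, Submodule.Quotient.eq] at hw
    refine ⟨-(x * s - r), a.neg_mem hw, x * s, Ideal.mem_span_singleton'.2 ⟨s, mul_comm _ _⟩, ?_⟩
    ring

variable [IsLocalRing R] [IsNoetherianRing R]

lemma quotient_devissage (P : ModuleCat R → Prop)
    (h0 : ∀ N : ModuleCat R, Subsingleton N → P N)
    (hext : ∀ {S : ShortComplex (ModuleCat R)}, S.ShortExact → P S.X₁ → P S.X₃ → P S.X₂)
    (hk : P (resField R))
    (hx : ∀ (N N' : ModuleCat R) (x : R) (g : N ⟶ N') (w : (x • 𝟙 N) ≫ g = 0),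
      x ∈ IsLocalRing.maximalIdeal R → Module.Finite R N →
      (ShortComplex.mk (x • 𝟙 N) g w).ShortExact → P N' → P N)
    (a : Ideal R) : P (ModuleCat.of R (R ⧸ a)) := by
  induction a using IsNoetherian.induction with
  | hgt a ih =>
  by_cases ha : IsLocalRing.maximalIdeal R ≤ a
  · by_cases hat : a = ⊤
    · subst hat
      exact h0 _ (inferInstanceAs (Subsingleton (R ⧸ (⊤ : Ideal R))))
    · obtain rfl := le_antisymm ha (IsLocalRing.le_maximalIdeal hat)
      exact hk
  · obtain ⟨x, hxm, hxa⟩ := SetLike.not_le_iff_exists.1 ha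
    have hlt : a < a ⊔ Ideal.span {x} := by
      refine lt_of_le_of_ne le_sup_left fun h => hxa ?_
      rw [h]
      exact Ideal.mem_sup_right (Ideal.mem_span_singleton_self x)
    have hle : a ≤ Submodule.comap (LinearMap.lsmul R R x) a := fun y hy =>
      Ideal.mul_mem_left a x hy
    by_cases hc : Submodule.comap (LinearMap.lsmul R R x) a = a
    · have hinj : Function.Injective (x • LinearMap.id : (R ⧸ a) →ₗ[R] R ⧸ a) := by
        rw [← LinearMap.ker_eq_bot, LinearMap.ker_eq_bot']
        intro z hz
        obtain ⟨r, rfl⟩ := Submodule.Quotient.mk_surjective _ z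
        rw [LinearMap.smul_apply, LinearMap.id_apply, ← Submodule.Quotient.mk_smul,
          Submodule.Quotient.mk_eq_zero] at hz
        rw [Submodule.Quotient.mk_eq_zero, ← hc]
        exact hz
      have hexact : Function.Exact (x • LinearMap.id : (R ⧸ a) →ₗ[R] R ⧸ a)
          (Submodule.factor (le_sup_left : a ≤ a ⊔ Ideal.span {x})) := by
        intro z
        rw [colonMul_exact a x z]
        constructor
        · rintro ⟨w, rfl⟩
          obtain ⟨s, rfl⟩ := Submodule.Quotient.mk_surjective _ w
          exact ⟨Submodule.Quotient.mk s, rfl⟩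
        · rintro ⟨w, rfl⟩
          obtain ⟨s, rfl⟩ := Submodule.Quotient.mk_surjective _ w
          exact ⟨Submodule.Quotient.mk s, rfl⟩
      have := ModuleCat.shortExact_of_functions _ _ hinj (Submodule.factor_surjective _) hexact
      exact hx _ _ x _ _ hxm (inferInstanceAs (Module.Finite R (R ⧸ a))) this (ih _ hlt)
    · have hlt' := lt_of_le_of_ne hle (Ne.symm hc)
      exact hext (ModuleCat.shortExact_of_functions _ _ (colonMul_injective a x)
        (Submodule.factor_surjective _) (colonMul_exact a x)) (ih _ hlt') (ih _ hlt)

lemma module_devissage (P : ModuleCat R → Prop)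
    (h0 : ∀ N : ModuleCat R, Subsingleton N → P N)
    (hext : ∀ {S : ShortComplex (ModuleCat R)}, S.ShortExact → P S.X₁ → P S.X₃ → P S.X₂)
    (hk : P (resField R))
    (hx : ∀ (N N' : ModuleCat R) (x : R) (g : N ⟶ N') (w : (x • 𝟙 N) ≫ g = 0),
      x ∈ IsLocalRing.maximalIdeal R → Module.Finite R N →
      (ShortComplex.mk (x • 𝟙 N) g w).ShortExact → P N' → P N)
    (N : ModuleCat R) (hN : Module.Finite R N) : P N := by
  have key := IsNoetherianRing.induction_on_isQuotientEquivQuotientPrime R hN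
    (motive := fun N _ _ _ => P (ModuleCat.of R N))
    (fun N _ _ _ hN => h0 _ hN) ?_ ?_
  · exact key
  · intro N _ _ _ p e
    refine hext (ModuleCat.shortExact_of_functions (e.symm : (R ⧸ p.1) →ₗ[R] N)
      (0 : N →ₗ[R] PUnit) e.symm.injective (Function.surjective_to_subsingleton _)
      ((e.symm.exact_zero_iff_surjective _).2 e.symm.surjective)) ?_ (h0 _ ?_)
    · exact quotient_devissage P h0 hext hk hx p.1
    · exact inferInstanceAs (Subsingleton PUnit)
  · intro N₁ _ _ _ N₂ _ _ _ N₃ _ _ _ f g hf hg h h₁ h₃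
    exact hext (ModuleCat.shortExact_of_functions f g hf hg h) h₁ h₃

/-- Properties of complexes with finite homology over a noetherian local ring can be checked on
shifts of the residue field, provided they lift along quotients by regular elements. -/
lemma local_devissage (P : Cx R → Prop)
    (hq : ∀ {X Y : Cx R} (f : X ⟶ Y), QuasiIso f → (P X ↔ P Y))
    (hext : ∀ {S : ShortComplex (Cx R)}, S.ShortExact → P S.X₁ → P S.X₃ → P S.X₂)
    (h0 : ∀ X : Cx R, IsZero X → P X)
    (hk : ∀ n : ℤ, P (sg n (resField R)))
    (hx : ∀ (X Y : Cx R) (x : R) (g : X ⟶ Y) (w : (x • 𝟙 X) ≫ g = 0),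
      x ∈ IsLocalRing.maximalIdeal R → HasFiniteHomology R X →
      (ShortComplex.mk (x • 𝟙 X) g w).ShortExact → P Y → P X)
    (M : Cx R) (hM : HasFiniteHomology R M) : P M := by
  refine complex_devissage P hq hext (fun n N hN => ?_) M hM
  have hsl : ∀ {S : ShortComplex (ModuleCat R)}, S.ShortExact →
      (S.map (HomologicalComplex.single (ModuleCat R) (ComplexShape.up ℤ) n)).ShortExact :=
    fun hS => hS.map_of_exact _
  refine module_devissage (fun N => P (sg n N)) ?_ ?_ (hk n) ?_ N hN
  · intro N hN
    exact h0 _ ((HomologicalComplex.single (ModuleCat R) (ComplexShape.up ℤ) n).map_isZero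
      (ModuleCat.isZero_of_subsingleton N))
  · intro S hS h₁ h₃
    exact hext (hsl hS) h₁ h₃
  · intro N N' x g w hxm hN hS hN'
    have hS' := hsl hS
    have e : (HomologicalComplex.single (ModuleCat R) (ComplexShape.up ℤ) n).map (x • 𝟙 N) =
      x • 𝟙 (sg n N) := by
      refine HomologicalComplex.from_single_hom_ext ?_
      rw [HomologicalComplex.single_map_f_self, HomologicalComplex.smul_f_apply,
        HomologicalComplex.id_f]
      simp
    refine hx (sg n N) (sg n N') x
      ((HomologicalComplex.single (ModuleCat R) (ComplexShape.up ℤ) n).map g) ?_ hxm ?_ ?_ hN'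
    · rw [← e, ← Functor.map_comp, w, Functor.map_zero]
    · exact hasFiniteHomology_sg n N hN
    · have : ∀ f (h : f = (HomologicalComplex.single (ModuleCat R) (ComplexShape.up ℤ) n).map
          (x • 𝟙 N)) w', (ShortComplex.mk f ((HomologicalComplex.single (ModuleCat R)
            (ComplexShape.up ℤ) n).map g) w').ShortExact := by
        rintro _ rfl _
        exact hS'
      exact this _ e.symm _

end LocalDevissage

section ProjectiveResolution

variable {C : Type*} [Category* C] [Abelian C]

/-- The cochain complex in the opposite category attached to a cochain complex. -/
def CochainComplex.opCx (L : CochainComplex C ℤ) : CochainComplex Cᵒᵖ ℤ where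
  X n := Opposite.op (L.X (-n))
  d i j := (L.d (-j) (-i)).op
  shape i j h := by
    rw [L.shape, op_zero]
    intro h'
    apply h
    simp only [ComplexShape.up_Rel] at h' ⊢
    omega
  d_comp_d' i j k _ _ := by rw [← op_comp, L.d_comp_d, op_zero]

/-- The cochain complex attached to a cochain complex in the opposite category. -/
def CochainComplex.unopCx (J : CochainComplex Cᵒᵖ ℤ) : CochainComplex C ℤ where
  X n := (J.X (-n)).unop
  d i j := (J.d (-j) (-i)).unop
  shape i j h := by
    rw [J.shape, unop_zero]
    intro h'
    apply h
    simp only [ComplexShape.up_Rel] at h' ⊢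
    omega
  d_comp_d' i j k _ _ := by rw [← unop_comp, J.d_comp_d, unop_zero]

/-- The functoriality of `CochainComplex.unopCx`. -/
def CochainComplex.unopCxMap {J J' : CochainComplex Cᵒᵖ ℤ} (i : J ⟶ J') :
    J'.unopCx ⟶ J.unopCx where
  f n := (i.f (-n)).unop
  comm' p q _ := by
    change (i.f (-p)).unop ≫ (J.d (-q) (-p)).unop = (J'.d (-q) (-p)).unop ≫ (i.f (-q)).unop
    rw [← unop_comp, ← unop_comp, i.comm]

lemma CochainComplex.quasiIso_unopCxMap {J J' : CochainComplex Cᵒᵖ ℤ} (i : J ⟶ J') [QuasiIso i] :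
    QuasiIso (unopCxMap i) := by
  rw [quasiIso_iff]
  intro n
  rw [quasiIsoAt_iff' _ (n - 1) n (n + 1) (by simp) (by simp)]
  have h : QuasiIsoAt i (-n) := inferInstance
  rw [quasiIsoAt_iff' _ (-(n + 1)) (-n) (-(n - 1)) (by simp; ring) (by simp; ring)] at h
  exact ShortComplex.quasiIso_unopMap
    ((HomologicalComplex.shortComplexFunctor' Cᵒᵖ (ComplexShape.up ℤ) (-(n + 1)) (-n)
      (-(n - 1))).map i)

/-- A cochain complex is isomorphic to its double opposite. -/
def CochainComplex.unopCxOpCxIso (L : CochainComplex C ℤ) : L.opCx.unopCx ≅ L :=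
  HomologicalComplex.Hom.isoOfComponents (fun n => L.XIsoOfEq (neg_neg n)) (by
    intro i j _
    change (L.XIsoOfEq (neg_neg i)).hom ≫ L.d i j =
      L.d (- -i) (- -j) ≫ (L.XIsoOfEq (neg_neg j)).hom
    simp)

lemma CochainComplex.exists_quasiIso_projective [EnoughProjectives C] (L : CochainComplex C ℤ)
    (b : ℤ) [L.IsStrictlyLE b] :
    ∃ (F : CochainComplex C ℤ) (f : F ⟶ L), QuasiIso f ∧ (∀ n, Projective (F.X n)) ∧
      F.IsStrictlyLE b := by
  have : L.opCx.IsStrictlyGE (-b) := by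
    rw [CochainComplex.isStrictlyGE_iff]
    intro i hi
    exact (CochainComplex.isZero_of_isStrictlyLE L b (-i) (by omega)).op
  obtain ⟨J, i, _, hJ, hJ'⟩ :=
    CochainComplex.Plus.modelCategoryQuillen.exists_quasiIso_injective L.opCx (-b)
  have := quasiIso_unopCxMap i
  refine ⟨J.unopCx, unopCxMap i ≫ L.unopCxOpCxIso.hom, inferInstance, fun n => ?_, ?_⟩
  · have := hJ (-n)
    exact Injective.projective_iff_injective_op.2 this
  · rw [CochainComplex.isStrictlyLE_iff]
    intro i hi
    exact (CochainComplex.isZero_of_isStrictlyGE J (-b) (-i) (by omega)).unop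

lemma exists_isSemiprojResolution {R : Type} [CommRing R] (M : Cx R) (hM : HasFiniteHomology R M) :
    ∃ (F : Cx R) (π : F ⟶ M), IsSemiprojResolution π := by
  obtain ⟨-, a, b, hab⟩ := hM
  have : M.IsLE b := by
    rw [CochainComplex.isLE_iff]
    intro i hi
    rw [HomologicalComplex.exactAt_iff_isZero_homology]
    exact hab i (Or.inr hi)
  obtain ⟨F, f, _, hF, hF'⟩ := CochainComplex.exists_quasiIso_projective (M.truncLE b) b
  refine ⟨F, f ≫ M.ιTruncLE b, hF, ⟨b + 1, fun n hn => ?_⟩, inferInstance⟩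
  exact CochainComplex.isZero_of_isStrictlyLE F b n (by omega)

end ProjectiveResolution

section FiniteDual

variable {R : Type} [CommRing R]

lemma δ_fromSingleMk_eq_zero_iff {n j q : ℤ} {N : ModuleCat R} {I : Cx R} (f : N ⟶ I.X q)
    (h : n + j = q) :
    δ j (j + 1) (Cochain.fromSingleMk f h) = 0 ↔ f ≫ I.d q (q + 1) = 0 := by
  rw [Cochain.δ_fromSingleMk f h (j + 1) (q + 1) (by omega),
    ← Cochain.fromSingleMk_zero N I n (q + 1) (j + 1) (by omega)]
  exact (Cochain.fromSingleEquiv (by omega)).symm.injective.eq_iff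

lemma δ_fromSingleMk_eq_iff {n j q : ℤ} {N : ModuleCat R} {I : Cx R} (f : N ⟶ I.X q)
    (g : N ⟶ I.X (q - 1)) (h : n + j = q) (h' : n + (j - 1) = q - 1) :
    δ (j - 1) j (Cochain.fromSingleMk g h') = Cochain.fromSingleMk f h ↔
      g ≫ I.d (q - 1) q = f := by
  rw [Cochain.δ_fromSingleMk g h' j q h]
  exact (Cochain.fromSingleEquiv h).symm.injective.eq_iff

lemma fromSingleMk_smul {n j q : ℤ} {N : ModuleCat R} {I : Cx R} (r : R) (f : N ⟶ I.X q)
    (h : n + j = q) :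
    Cochain.fromSingleMk (r • f) h = r • Cochain.fromSingleMk f h := by
  refine (Cochain.fromSingleEquiv h).injective ?_
  rw [Cochain.fromSingleEquiv_fromSingleMk]
  change _ = _ ≫ (r • Cochain.fromSingleMk f h).v n q h
  rw [Cochain.smul_v, Cochain.fromSingleMk_v]
  exact (congrArg (r • ·) (Iso.inv_hom_id_assoc _ _).symm).trans
    (Linear.comp_smul _ _ _ _ _ _).symm

lemma isZero_homology_homCx_sg_iff (n j q : ℤ) (h : n + j = q) (N : ModuleCat R) (I : Cx R) :
    IsZero ((homCx (sg n N) I).homology j) ↔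
      ∀ f : N ⟶ I.X q, f ≫ I.d q (q + 1) = 0 → ∃ g : N ⟶ I.X (q - 1), g ≫ I.d (q - 1) q = f := by
  rw [Cx.isZero_homology_iff]
  constructor
  · intro H f hf
    obtain ⟨z, hz⟩ := H (Cochain.fromSingleMk f h) ((δ_fromSingleMk_eq_zero_iff f h).2 hf)
    obtain ⟨g, rfl⟩ := Cochain.fromSingleMk_surjective z (q - 1) (by omega)
    exact ⟨g, (δ_fromSingleMk_eq_iff f g h _).1 hz⟩
  · intro H z hz
    obtain ⟨f, rfl⟩ := Cochain.fromSingleMk_surjective z q h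
    obtain ⟨g, hg⟩ := H f ((δ_fromSingleMk_eq_zero_iff f h).1 hz)
    exact ⟨Cochain.fromSingleMk g (by omega), (δ_fromSingleMk_eq_iff f g h _).2 hg⟩

lemma isZero_homology_homCx_sg_of_lt (n j a : ℤ) (h : n + j < a) (N : ModuleCat R) (I : Cx R)
    [I.IsStrictlyGE a] : IsZero ((homCx (sg n N) I).homology j) := by
  rw [isZero_homology_homCx_sg_iff n j _ rfl]
  intro f _
  exact ⟨0, (CochainComplex.isZero_of_isStrictlyGE I a _ h).eq_of_tgt _ _⟩

lemma isZero_homology_homCx_sg_of_projective (n j q : ℤ) (h : n + j = q) (N : ModuleCat R)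
    [Projective N] (I : Cx R) (hI : IsZero (I.homology q)) :
    IsZero ((homCx (sg n N) I).homology j) := by
  rw [isZero_homology_homCx_sg_iff n j q h]
  intro f hf
  have he : (I.sc' (q - 1) q (q + 1)).Exact := by
    rw [← HomologicalComplex.exactAt_iff' _ _ _ _ (by simp) (by simp),
      HomologicalComplex.exactAt_iff_isZero_homology]
    exact hI
  exact ⟨he.liftFromProjective f hf, he.liftFromProjective_comp f hf⟩

lemma finite_homology_homCx_sg_self (n j q : ℤ) (h : n + j = q) (I : Cx R)
    (hI : Module.Finite R (I.homology q)) :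
    Module.Finite R ((homCx (sg n (ModuleCat.of R R)) I).homology j) := by
  let φ : LinearMap.ker (I.d q (q + 1)).hom →ₗ[R]
      LinearMap.ker ((homCx (sg n (ModuleCat.of R R)) I).d j (j + 1)).hom :=
    { toFun x := ⟨Cochain.fromSingleMk (ModuleCat.ofHom (LinearMap.toSpanSingleton R _ x.1)) h,
        (δ_fromSingleMk_eq_zero_iff _ h).2 (by
          refine ModuleCat.hom_ext (LinearMap.ext fun z => ?_)
          change I.d q (q + 1) (z • x.1) = 0
          rw [map_smul]
          exact (congrArg (z • ·) x.2).trans (smul_zero z))⟩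
      map_add' x y := Subtype.ext (by
        refine Eq.trans (congrArg (fun f => Cochain.fromSingleMk f h) ?_)
          (Cochain.fromSingleMk_add _ _ h)
        refine ModuleCat.hom_ext (LinearMap.ext fun z => ?_)
        exact smul_add z _ _)
      map_smul' r x := Subtype.ext (by
        refine Eq.trans (congrArg (fun f => Cochain.fromSingleMk f h) ?_)
          (fromSingleMk_smul r _ h)
        refine ModuleCat.hom_ext (LinearMap.ext fun z => ?_)
        exact smul_comm z r _) }
  let L := ((homCx (sg n (ModuleCat.of R R)) I).cls j).comp φ
  have hL : Function.Surjective L := by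
    refine (Cx.cls_surjective _ _).comp fun z => ?_
    obtain ⟨z, hz⟩ := z
    obtain ⟨f, rfl⟩ := Cochain.fromSingleMk_surjective z q h
    have : f ≫ I.d q (q + 1) = 0 := (δ_fromSingleMk_eq_zero_iff f h).1 hz
    refine ⟨⟨f (1 : R), ?_⟩, Subtype.ext ?_⟩
    · exact congrArg (fun g => g (1 : R)) this
    · refine congrArg (fun f => Cochain.fromSingleMk f h) ?_
      refine ModuleCat.hom_ext (LinearMap.ext_ring ?_)
      exact one_smul R _
  have hk : LinearMap.ker (I.cls q) ≤ LinearMap.ker L := by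
    intro x hx
    obtain ⟨y, hy⟩ := (I.cls_eq_zero_iff q x).1 hx
    refine (Cx.cls_eq_zero_iff _ _ _).2
      ⟨Cochain.fromSingleMk (ModuleCat.ofHom (LinearMap.toSpanSingleton R _ y)) (by omega), ?_⟩
    refine (δ_fromSingleMk_eq_iff _ _ h _).2 ?_
    refine ModuleCat.hom_ext (LinearMap.ext fun z => ?_)
    change I.d (q - 1) q (z • y) = z • x.1
    rw [map_smul, hy]
  have : Module.Finite R (LinearMap.ker (I.d q (q + 1)).hom ⧸ LinearMap.ker (I.cls q)) :=
    (Module.Finite.equiv_iff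
      (LinearMap.quotKerEquivOfSurjective _ (I.cls_surjective q))).2 hI
  refine Module.Finite.of_surjective ((LinearMap.ker (I.cls q)).liftQ L hk) ?_
  rw [← LinearMap.range_eq_top, Submodule.range_liftQ, LinearMap.range_eq_top]
  exact hL

lemma shortExact_sg {S : ShortComplex (ModuleCat R)} (hS : S.ShortExact) (n : ℤ) :
    (S.map (HomologicalComplex.single (ModuleCat R) (ComplexShape.up ℤ) n)).ShortExact :=
  hS.map_of_exact _

variable [IsNoetherianRing R]

lemma finite_of_exact {A B C : Type*} [AddCommGroup A] [Module R A]
    [AddCommGroup B] [Module R B] [AddCommGroup C] [Module R C] (f : A →ₗ[R] B) (g : B →ₗ[R] C)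
    (h : Function.Exact f g) (hA : Module.Finite R A) (hC : Module.Finite R C) :
    Module.Finite R B := by
  rw [Module.finite_def]
  refine Submodule.fg_of_fg_map_of_fg_inf_ker g (IsNoetherian.noetherian _) ?_
  rw [top_inf_eq, (LinearMap.exact_iff).1 h]
  exact Module.Finite.iff_fg.1 inferInstance

variable (I : Cx.{0} R) [∀ n, Injective (I.X n)]

lemma finite_dual_middle {S : ShortComplex (Cx R)} (hS : S.ShortExact) (j : ℤ)
    (h₁ : Module.Finite R ((homCx S.X₁ I).homology j))
    (h₃ : Module.Finite R ((homCx S.X₃ I).homology j)) :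
    Module.Finite R ((homCx S.X₂ I).homology j) :=
  finite_of_exact _ _ (les_exact₂ (homCx.shortExact_L I hS) j) h₃ h₁

lemma finite_dual_right {S : ShortComplex (Cx R)} (hS : S.ShortExact) (j j' : ℤ)
    (h : j + 1 = j') (h₁ : Module.Finite R ((homCx S.X₁ I).homology j))
    (h₂ : Module.Finite R ((homCx S.X₂ I).homology j')) :
    Module.Finite R ((homCx S.X₃ I).homology j') := by
  subst h
  exact finite_of_exact _ _ (les_exact₁ (homCx.shortExact_L I hS) j) h₁ h₂

lemma finite_dual_sg (a : ℤ) [I.IsStrictlyGE a] (hI : ∀ j, Module.Finite R (I.homology j))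
    (n j : ℤ) (N : ModuleCat R) (hN : Module.Finite R N) :
    Module.Finite R ((homCx (sg n N) I).homology j) := by
  suffices H : ∀ (k : ℕ) (N : ModuleCat R), Module.Finite R N →
      Module.Finite R ((homCx (sg n N) I).homology (a - n - 1 + k)) by
    by_cases hj : n + j < a
    · exact finite_of_isZero (isZero_homology_homCx_sg_of_lt n j a hj N I)
    · obtain ⟨k, hk⟩ := Int.eq_ofNat_of_zero_le (a := j - (a - n - 1)) (by omega)
      obtain rfl : j = a - n - 1 + k := by omega
      exact H k N hN
  intro k
  induction k with
  | zero =>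
    intro N _
    exact finite_of_isZero (isZero_homology_homCx_sg_of_lt n _ a (by push_cast; omega) N I)
  | succ k ih =>
    intro N hN
    have key := IsNoetherianRing.induction_on_isQuotientEquivQuotientPrime R hN
      (motive := fun N _ _ _ =>
        Module.Finite R ((homCx (sg n (ModuleCat.of R N)) I).homology (a - n - 1 + (k + 1 : ℕ))))
      ?_ ?_ ?_
    · exact key
    · intro N _ _ _ hN
      refine finite_of_isZero ((isZero_homology_homCx_sg_iff _ _ _ rfl _ _).2 fun f _ => ⟨0, ?_⟩)
      exact (ModuleCat.isZero_of_subsingleton (ModuleCat.of R N)).eq_of_src _ _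
    · intro N _ _ _ p e
      have hex : Function.Exact p.1.subtype (e.symm.toLinearMap.comp p.1.mkQ) := by
        rw [LinearMap.exact_iff, LinearMap.ker_comp, LinearEquiv.ker, Submodule.range_subtype]
        simp
      exact finite_dual_right I (shortExact_sg (ModuleCat.shortExact_of_functions p.1.subtype
        (e.symm.toLinearMap.comp p.1.mkQ) (Submodule.subtype_injective _)
        (e.symm.surjective.comp (Submodule.mkQ_surjective _)) hex) n) (a - n - 1 + k) _
        (by push_cast; ring)
        (ih (ModuleCat.of R p.1) (Module.Finite.iff_fg.2 (IsNoetherian.noetherian p.1)))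
        (finite_homology_homCx_sg_self n _ _ rfl I (hI _))
    · intro N₁ _ _ _ N₂ _ _ _ N₃ _ _ _ f g hf hg h h₁ h₃
      exact finite_dual_middle I (shortExact_sg (ModuleCat.shortExact_of_functions f g hf hg h) n)
        _ h₁ h₃

/-- Dualizing into a bounded below complex of injectives with finite homology preserves
finiteness of the homology. -/
lemma finite_dual (a : ℤ) [I.IsStrictlyGE a] (hI : ∀ j, Module.Finite R (I.homology j))
    (M : Cx R) (hM : HasFiniteHomology R M) (j : ℤ) :
    Module.Finite R ((homCx M I).homology j) := by
  have : I.IsKInjective := CochainComplex.isKInjective_of_injective I a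
  refine complex_devissage (fun M => Module.Finite R ((homCx M I).homology j)) ?_ ?_ ?_ M hM
  · intro X Y f _
    have := homCx.quasiIso_mapL f I
    exact (finite_of_quasiIsoAt (homCx.mapL f I) j inferInstance).symm
  · intro S hS h₁ h₃
    exact finite_dual_middle I hS j h₁ h₃
  · intro n N hN
    exact finite_dual_sg I a hI n j N hN

end FiniteDual

section DualizingInjective

variable {R : Type} [CommRing R]

lemma Cx.homologyMap_eq_smul {K : Cx R} (f : K ⟶ K) (n : ℤ) (x : R)
    (h : ∀ z : K.X n, f.f n z = x • z) (y : K.homology n) :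
    HomologicalComplex.homologyMap f n y = x • y := by
  obtain ⟨y, rfl⟩ := K.cls_surjective n y
  rw [← map_smul]
  exact Cx.homologyMap_cls f n y (x • y) (h y.1)

lemma Cochain.ofHom_smul_id_comp {A B : Cx R} {n : ℤ} (x : R) (z : Cochain A B n) :
    (Cochain.ofHom (x • 𝟙 A)).comp z (zero_add n) = x • z := by
  refine Cochain.ext _ _ fun p q hpq => ?_
  rw [Cochain.zero_cochain_comp_v, Cochain.ofHom_v, Cochain.smul_v, HomologicalComplex.smul_f_apply,
    HomologicalComplex.id_f, Linear.smul_comp, Category.id_comp]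

lemma Cochain.comp_ofHom_smul_id {A B : Cx R} {n : ℤ} (x : R) (z : Cochain A B n) :
    z.comp (Cochain.ofHom (x • 𝟙 B)) (add_zero n) = x • z := by
  refine Cochain.ext _ _ fun p q hpq => ?_
  rw [Cochain.comp_zero_cochain_v, Cochain.ofHom_v, Cochain.smul_v, HomologicalComplex.smul_f_apply,
    HomologicalComplex.id_f, Linear.comp_smul, Category.comp_id]

lemma homologyMap_mapL_smul_id (A B : Cx R) (x : R) (n : ℤ) (y : (homCx A B).homology n) :
    HomologicalComplex.homologyMap (homCx.mapL (x • 𝟙 A) B) n y = x • y :=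
  Cx.homologyMap_eq_smul _ n x (fun _ => Cochain.ofHom_smul_id_comp x _) y

lemma homologyMap_mapR_smul_id (A B : Cx R) (x : R) (n : ℤ) (y : (homCx A B).homology n) :
    HomologicalComplex.homologyMap (homCx.mapR A (x • 𝟙 B)) n y = x • y :=
  Cx.homologyMap_eq_smul _ n x (fun _ => Cochain.comp_ofHom_smul_id x _) y

lemma isZero_of_exact {A B C : ModuleCat R} (f : A →ₗ[R] B) (g : B →ₗ[R] C)
    (h : Function.Exact f g) (hA : IsZero A) (hC : IsZero C) : IsZero B := by
  rw [ModuleCat.isZero_iff_subsingleton] at hA hC ⊢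
  refine subsingleton_of_forall_eq 0 fun b => ?_
  obtain ⟨a, rfl⟩ := (h b).1 (Subsingleton.elim _ _)
  rw [Subsingleton.elim a 0, map_zero]

lemma isZero_homology_homCx_of_isZero {X : Cx R} (hX : IsZero X) (I : Cx R) (j : ℤ) :
    IsZero ((homCx X I).homology j) := by
  rw [Cx.isZero_homology_iff]
  intro z _
  have hz : homCx.toCochain z = 0 := Cochain.ext _ _ fun p q hpq =>
    ((HomologicalComplex.eval _ _ p).map_isZero hX).eq_of_src _ _
  exact ⟨0, (map_zero _).trans hz.symm⟩

lemma nakayama_isZero [IsLocalRing R] {N : ModuleCat R} (hN : Module.Finite R N) (x : R)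
    (hx : x ∈ IsLocalRing.maximalIdeal R) (h : ∀ y : N, ∃ z : N, x • z = y) : IsZero N := by
  rw [ModuleCat.isZero_iff_subsingleton, ← Submodule.subsingleton_iff R,
    ← subsingleton_iff_bot_eq_top, eq_comm]
  refine Submodule.eq_bot_of_le_smul_of_le_jacobson_bot (IsLocalRing.maximalIdeal R) ⊤
    hN.fg_top ?_ (IsLocalRing.maximalIdeal_le_jacobson _)
  intro y _
  obtain ⟨z, rfl⟩ := h y
  exact Submodule.smul_mem_smul hx trivial

/-- The class of the cocycle `y` generates `H^d(Hom(k, I))` and is nonzero. -/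
structure IsExtGenerator [IsLocalRing R] (I : Cx R) (d : ℤ) (y : resField R ⟶ I.X d) : Prop where
  comp_d : y ≫ I.d d (d + 1) = 0
  not_boundary : ∀ g : resField R ⟶ I.X (d - 1), g ≫ I.d (d - 1) d ≠ y
  generates : ∀ f : resField R ⟶ I.X d, f ≫ I.d d (d + 1) = 0 →
    ∃ (r : R) (g : resField R ⟶ I.X (d - 1)), f = r • y + g ≫ I.d (d - 1) d

/-- `I` is a bounded below complex of injectives with finite homology such that
`Hom(k, I)` has homology `k`, concentrated in degree `d`. -/
structure IsDualizingInj (R : Type) [CommRing R] [IsLocalRing R] (I : Cx R) (a d : ℤ) : Prop where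
  inj : ∀ n, Injective (I.X n)
  ge : I.IsStrictlyGE a
  fin : ∀ j, Module.Finite R (I.homology j)
  van : ∀ q, q ≠ d → ∀ f : resField R ⟶ I.X q, f ≫ I.d q (q + 1) = 0 →
    ∃ g : resField R ⟶ I.X (q - 1), g ≫ I.d (q - 1) q = f
  one : ∃ y : resField R ⟶ I.X d, IsExtGenerator I d y

variable [IsLocalRing R]

lemma IsDualizingInj.isKInjective {I : Cx R} {a d : ℤ} (h : IsDualizingInj R I a d) :
    I.IsKInjective := by
  have := h.inj
  have := h.ge
  exact CochainComplex.isKInjective_of_injective I a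

variable [IsNoetherianRing R]

lemma IsDualizingInj.finite_dual {I : Cx R} {a d : ℤ} (h : IsDualizingInj R I a d)
    (M : Cx R) (hM : HasFiniteHomology R M) : HasFiniteHomology R (homCx M I) := by
  have := h.inj
  have := h.ge
  have := h.isKInjective
  refine ⟨_root_.finite_dual I a h.fin M hM, ?_⟩
  refine local_devissage (fun M => ∃ a b : ℤ, ∀ n : ℤ, n < a ∨ b < n →
    IsZero ((homCx M I).homology n)) ?_ ?_ ?_ ?_ ?_ M hM
  · intro X Y f _
    have := homCx.quasiIso_mapL f I
    have e := fun n => isZero_homology_iff_of_quasiIsoAt (homCx.mapL f I) n inferInstance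
    simp only [e]
  · rintro S hS ⟨a₁, b₁, h₁⟩ ⟨a₃, b₃, h₃⟩
    refine ⟨min a₁ a₃, max b₁ b₃, fun n hn => ?_⟩
    exact isZero_of_exact _ _ (les_exact₂ (homCx.shortExact_L I hS) n)
      (h₃ n (by omega)) (h₁ n (by omega))
  · intro X hX
    exact ⟨0, 0, fun n _ => isZero_homology_homCx_of_isZero hX I n⟩
  · intro n
    refine ⟨d - n, d - n, fun j hj => ?_⟩
    rw [isZero_homology_homCx_sg_iff n j _ rfl]
    exact h.van _ (by omega)
  · rintro X Y x g w hx hX hS ⟨a', b', h'⟩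
    refine ⟨a' - 1, b', fun n hn => ?_⟩
    refine nakayama_isZero (_root_.finite_dual I a h.fin X hX n) x hx fun y => ?_
    obtain ⟨z, hz⟩ := (les_exact₃ (homCx.shortExact_L I hS) n y).1 (by
      have := h' (n + 1) (by omega)
      rw [ModuleCat.isZero_iff_subsingleton] at this
      exact @Subsingleton.elim _ this _ _)
    exact ⟨z, (homologyMap_mapL_smul_id X I x n z).symm.trans hz⟩

end DualizingInjective

section Swap

variable {R : Type} [CommRing R]

/-- The bilinear map underlying a cochain with values in a Hom complex. -/
def Cochain.ev {A B C : Cx R} {n : ℤ} (f : Cochain A (homCx B C) n) (p s q r : ℤ)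
    (h : p + n = s) (h' : q + s = r) : A.X p →ₗ[R] B.X q →ₗ[R] C.X r where
  toFun a := ((homCx.toCochain ((f.v p s h).hom a)).v q r h').hom
  map_add' a b := by rw [map_add]; rfl
  map_smul' x a := by rw [map_smul]; rfl

lemma Cochain.ext_ev {A B C : Cx R} {n : ℤ} {f g : Cochain A (homCx B C) n}
    (hfg : ∀ (p s q r : ℤ) (h : p + n = s) (h' : q + s = r) (a : A.X p) (b : B.X q),
      Cochain.ev f p s q r h h' a b = Cochain.ev g p s q r h h' a b) : f = g :=
  Cochain.ext _ _ fun p s h => ModuleCat.hom_ext (LinearMap.ext fun a =>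
    Cochain.ext _ _ fun q r h' => ModuleCat.hom_ext (LinearMap.ext fun b => hfg p s q r h h' a b))

/-- The cochain with values in a Hom complex given by a family of bilinear maps. -/
def Cochain.mkEv {A B C : Cx R} {n : ℤ}
    (e : ∀ (p q r : ℤ) (_ : p + q + n = r), A.X p →ₗ[R] B.X q →ₗ[R] C.X r) :
    Cochain A (homCx B C) n :=
  Cochain.mk fun p s hs => ModuleCat.ofHom (Y := Cochain B C s)
    { toFun := fun a => Cochain.mk fun q r hr => ModuleCat.ofHom (e p q r (by lia) a)
      map_add' := fun a b => Cochain.ext _ _ fun q r hr => by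
        simp only [Cochain.mk_v, map_add, Cochain.add_v]; rfl
      map_smul' := fun x a => Cochain.ext _ _ fun q r hr => by
        simp only [Cochain.mk_v, map_smul, Cochain.smul_v]; rfl }

lemma Cochain.δ_v_apply {A B : Cx R} {n : ℤ} (f : Cochain A B n) (p q q' p' m : ℤ)
    (hm : n + 1 = m) (h : p + m = q) (hq : q' + 1 = q) (hp : p + 1 = p') (a : A.X p) :
    (δ n m f).v p q h a = B.d q' q (f.v p q' (by lia) a) +
      m.negOnePow • f.v p' q (by lia) (A.d p p' a) := by
  rw [δ_v n m hm f p q h q' p' (by lia) hp]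
  rfl

lemma Cochain.ev_δ {A B C : Cx R} {n : ℤ} (f : Cochain A (homCx B C) n) (m p s q r : ℤ)
    (hm : n + 1 = m) (h : p + m = s) (h' : q + s = r) (a : A.X p) (b : B.X q) :
    Cochain.ev (δ n m f) p s q r h h' a b =
      C.d (r - 1) r (Cochain.ev f p (s - 1) q (r - 1) (by lia) (by lia) a b) +
      s.negOnePow • Cochain.ev f p (s - 1) (q + 1) r (by lia) (by lia) a (B.d q (q + 1) b) +
      m.negOnePow • Cochain.ev f (p + 1) s q r (by lia) h' (A.d p (p + 1) a) b := by
  have e1 : (δ n m f).v p s h a = _ :=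
    Cochain.δ_v_apply f p s (s - 1) (p + 1) m hm h (by lia) rfl a
  have e2 := Cochain.δ_v_apply (homCx.toCochain (f.v p (s - 1) (by lia) a)) q r (r - 1) (q + 1) s
    (by lia) h' (by lia) rfl b
  refine (congrArg (fun z => (homCx.toCochain z).v q r h' b) e1).trans ?_
  exact congrArg (· + m.negOnePow • Cochain.ev f (p + 1) s q r (by lia) h' (A.d p (p + 1) a) b) e2

/-- Exchanging the two arguments of a cochain with values in a Hom complex. -/
def Cochain.swap {A B C : Cx R} {n : ℤ} (f : Cochain A (homCx B C) n) :
    Cochain B (homCx A C) n :=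
  Cochain.mkEv fun q p r h => (p * q).negOnePow • (Cochain.ev f p (p + n) q r rfl (by lia)).flip

lemma Cochain.ev_swap {A B C : Cx R} {n : ℤ} (f : Cochain A (homCx B C) n) (p s s' q r : ℤ)
    (h : q + n = s) (h' : p + s = r) (h'' : p + n = s') (a : A.X p) (b : B.X q) :
    Cochain.ev (Cochain.swap f) q s p r h h' b a =
      (p * q).negOnePow • Cochain.ev f p s' q r h'' (by lia) a b := by
  subst h''
  rfl

lemma Cochain.swap_swap {A B C : Cx R} {n : ℤ} (f : Cochain A (homCx B C) n) :
    Cochain.swap (Cochain.swap f) = f := by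
  refine Cochain.ext_ev fun p s q r h h' a b => ?_
  rw [Cochain.ev_swap _ q s (q + n) p r h h' rfl, Cochain.ev_swap f p _ s q r _ _ h, smul_smul,
    mul_comm p q, Int.units_mul_self, one_smul]

lemma Cochain.δ_swap {A B C : Cx R} {n m : ℤ} (f : Cochain A (homCx B C) n) :
    δ n m (Cochain.swap f) = Cochain.swap (δ n m f) := by
  by_cases hm : n + 1 = m
  · refine Cochain.ext_ev fun q s p r h h' b a => ?_
    rw [Cochain.ev_swap _ p s (p + m) q r h h' rfl, Cochain.ev_δ _ _ _ _ _ _ hm,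
      Cochain.ev_δ _ _ _ _ _ _ hm,
      Cochain.ev_swap f p _ (p + m - 1) q (r - 1) _ _ (by lia),
      Cochain.ev_swap f (p + 1) _ (p + m) q r _ _ (by lia),
      Cochain.ev_swap f p _ (p + m - 1) (q + 1) r _ _ (by lia)]
    have e1 : s.negOnePow * ((p + 1) * q).negOnePow = (p * q).negOnePow * m.negOnePow := by
      rw [← Int.negOnePow_add, ← Int.negOnePow_add, Int.negOnePow_eq_iff]
      exact ⟨q, by rw [← h]; ring⟩
    have e2 : m.negOnePow * (p * (q + 1)).negOnePow = (p * q).negOnePow * (p + m).negOnePow := by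
      rw [← Int.negOnePow_add, ← Int.negOnePow_add]
      congr 1
      ring
    have e0 : ∀ (u : ℤˣ) (z : C.X (r - 1)), C.d (r - 1) r (u • z) = u • C.d (r - 1) r z :=
      fun u z => by rw [Units.smul_def, map_zsmul]; rfl
    rw [e0, smul_smul, smul_smul, e1, e2, smul_add, smul_add, smul_smul, smul_smul,
      add_right_comm]
  · rw [δ_shape _ _ hm, δ_shape _ _ hm]
    refine Cochain.ext_ev fun q s p r h h' b a => ?_
    rw [Cochain.ev_swap _ p s (p + m) q r h h' rfl]
    exact (smul_zero _).symm

/-- Exchanging the two sources in an iterated Hom complex. -/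
def homCx.swap (A B C : Cx R) : homCx A (homCx B C) ⟶ homCx B (homCx A C) where
  f n := ModuleCat.ofHom (X := Cochain A (homCx B C) n) (Y := Cochain B (homCx A C) n)
    { toFun := Cochain.swap
      map_add' := fun f g => Cochain.ext_ev fun q s p r h h' b a => by
        refine (Cochain.ev_swap _ p s (p + n) q r h h' rfl a b).trans ?_
        exact smul_add _ _ _
      map_smul' := fun x f => Cochain.ext_ev fun q s p r h h' b a => by
        refine (Cochain.ev_swap _ p s (p + n) q r h h' rfl a b).trans ?_
        exact smul_comm _ x _ }
  comm' _ _ _ := ModuleCat.hom_ext (LinearMap.ext fun f => Cochain.δ_swap f)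

/-- The symmetry of the two sources in an iterated Hom complex. -/
def homCx.swapIso (A B C : Cx R) : homCx A (homCx B C) ≅ homCx B (homCx A C) where
  hom := homCx.swap A B C
  inv := homCx.swap B A C
  hom_inv_id := HomologicalComplex.hom_ext _ _ fun _ =>
    ModuleCat.hom_ext (LinearMap.ext fun f => Cochain.swap_swap f)
  inv_hom_id := HomologicalComplex.hom_ext _ _ fun _ =>
    ModuleCat.hom_ext (LinearMap.ext fun f => Cochain.swap_swap f)

/-- The biduality morphism of a complex with respect to another one. -/
def biduality (I M : Cx R) : M ⟶ homCx (homCx M I) I :=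
  Cocycle.homOf (Cocycle.mk (Cochain.swap (Cochain.ofHom (𝟙 (homCx M I)))) 1 (zero_add 1) (by
    rw [Cochain.δ_swap, δ_ofHom]
    exact ((homCx.swap (homCx M I) M I).f 1).hom.map_zero))

lemma ofHom_biduality (I M : Cx R) :
    Cochain.ofHom (biduality I M) = Cochain.swap (Cochain.ofHom (𝟙 (homCx M I))) :=
  Cocycle.cochain_ofHom_homOf_eq_coe _

lemma ev_biduality (I M : Cx R) (p s q r : ℤ) (h : p + 0 = s) (h' : q + s = r) (x : M.X p)
    (φ : (homCx M I).X q) :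
    Cochain.ev (Cochain.ofHom (biduality I M)) p s q r h h' x φ =
      (q * p).negOnePow • (homCx.toCochain φ).v p r (by lia) x := by
  rw [ofHom_biduality, Cochain.ev_swap _ q s q p r h h' (by lia)]
  refine congrArg (fun z => (q * p).negOnePow • z) ?_
  refine congrArg (fun z => (homCx.toCochain (B := I) z).v p r (by lia) x) ?_
  exact congrArg (fun f => f φ) (congrArg ModuleCat.Hom.hom (Cochain.ofHom_v (𝟙 (homCx M I)) q))

lemma biduality_f_v (I M : Cx R) (p q r : ℤ) (h' : q + p = r) (x : M.X p)
    (φ : (homCx M I).X q) :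
    (homCx.toCochain ((biduality I M).f p x)).v q r h' φ =
      (q * p).negOnePow • (homCx.toCochain φ).v p r (by lia) x := by
  refine Eq.trans ?_ (ev_biduality I M p p q r (by lia) h' x φ)
  refine congrArg (fun z => (homCx.toCochain (A := homCx M I) (B := I) z).v q r h' φ) ?_
  exact congrArg (fun f => f x) (congrArg ModuleCat.Hom.hom
    (Cochain.ofHom_v (biduality I M) p).symm)

lemma biduality_naturality (I : Cx R) {M N : Cx R} (f : M ⟶ N) :
    biduality I M ≫ homCx.mapL (homCx.mapL f I) I = f ≫ biduality I N := by
  refine HomologicalComplex.hom_ext _ _ fun p => ModuleCat.hom_ext (LinearMap.ext fun x => ?_)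
  refine Cochain.ext _ _ fun q r h => ModuleCat.hom_ext (LinearMap.ext fun φ => ?_)
  refine Eq.trans ?_ (biduality_f_v I N p q r h (f.f p x) φ).symm
  refine Eq.trans ?_ ((biduality_f_v I M p q r h x ((homCx.mapL f I).f q φ)).trans ?_)
  · refine congrArg (fun z => (ModuleCat.Hom.hom z) φ) (Cochain.zero_cochain_comp_v
      (Cochain.ofHom (homCx.mapL f I)) (homCx.toCochain ((biduality I M).f p x)) q r h) |>.trans ?_
    refine congrArg (fun z => (homCx.toCochain ((biduality I M).f p x)).v q r h z) ?_
    exact congrArg (fun f => f φ) (congrArg ModuleCat.Hom.hom (Cochain.ofHom_v (homCx.mapL f I) q))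
  · refine congrArg (fun z => (q * p).negOnePow • z) ?_
    refine congrArg (fun z => (ModuleCat.Hom.hom z) x) (Cochain.zero_cochain_comp_v
      (Cochain.ofHom f) (homCx.toCochain φ) p r (by lia)) |>.trans ?_
    refine congrArg (fun z => (homCx.toCochain φ).v p r (by lia) z) ?_
    exact congrArg (fun f => f x) (congrArg ModuleCat.Hom.hom (Cochain.ofHom_v f p))

end Swap

section BidualityResidueField

variable {R : Type} [CommRing R]

/-- The inclusion of a module into the corresponding term of a single complex. -/
def sgIn (n : ℤ) (N : ModuleCat R) : N ⟶ (sg n N).X n :=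
  (HomologicalComplex.singleObjXSelf (.up ℤ) n N).inv

lemma sgIn_surjective (n : ℤ) (N : ModuleCat R) : Function.Surjective (sgIn n N) := fun x =>
  ⟨(HomologicalComplex.singleObjXSelf (.up ℤ) n N).hom x,
    congrArg (fun f => f x) (congrArg ModuleCat.Hom.hom
      (HomologicalComplex.singleObjXSelf (.up ℤ) n N).hom_inv_id)⟩

/-- The morphism from a single complex given by a cocycle. -/
def sgDesc {n : ℤ} {N : ModuleCat R} {K : Cx R} (φ : N ⟶ K.X n) (hφ : φ ≫ K.d n (n + 1) = 0) :
    sg n N ⟶ K :=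
  HomologicalComplex.mkHomFromSingle φ (by rintro _ rfl; exact hφ)

lemma sgDesc_f_sgIn {n : ℤ} {N : ModuleCat R} {K : Cx R} (φ : N ⟶ K.X n)
    (hφ : φ ≫ K.d n (n + 1) = 0) (z : N) : (sgDesc φ hφ).f n (sgIn n N z) = φ z := by
  have : sgIn n N ≫ (sgDesc φ hφ).f n = φ :=
    (congrArg (sgIn n N ≫ ·) (HomologicalComplex.mkHomFromSingle_f _ _)).trans
      (Iso.inv_hom_id_assoc _ _)
  exact congrArg (fun f : N ⟶ K.X n => f z) this

lemma fromSingleMk_v_sgIn {n j q : ℤ} {N : ModuleCat R} {I : Cx R} (f : N ⟶ I.X q)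
    (h : n + j = q) (z : N) : (Cochain.fromSingleMk f h).v n q h (sgIn n N z) = f z := by
  have : sgIn n N ≫ (Cochain.fromSingleMk f h).v n q h = f :=
    (congrArg (sgIn n N ≫ ·) (Cochain.fromSingleMk_v f h)).trans (Iso.inv_hom_id_assoc _ _)
  exact congrArg (fun f : N ⟶ I.X q => f z) this

lemma isZero_sg_X (n i : ℤ) (hi : i ≠ n) (N : ModuleCat R) : IsZero ((sg n N).X i) :=
  HomologicalComplex.isZero_single_obj_X (.up ℤ) n N i hi

lemma quasiIso_of_sg {m : ℤ} {N : ModuleCat R} {K : Cx R} (f : sg m N ⟶ K)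
    (van : ∀ j, j ≠ m → IsZero (K.homology j))
    (inj : ∀ (z : N) (y : K.X (m - 1)), K.d (m - 1) m y = f.f m (sgIn m N z) → z = 0)
    (surj : ∀ x : K.X m, K.d m (m + 1) x = 0 → ∃ (z : N) (y : K.X (m - 1)),
      x = f.f m (sgIn m N z) + K.d (m - 1) m y) : QuasiIso f := by
  rw [Cx.quasiIso_iff_elements]
  intro n
  by_cases hn : n = m
  · subst hn
    refine ⟨fun x y hx hy => ?_, fun y hy => ?_⟩
    · obtain ⟨z, rfl⟩ := sgIn_surjective n N x
      exact ⟨0, by rw [inj z y hy, map_zero, map_zero]⟩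
    · obtain ⟨z, w, h⟩ := surj y hy
      have := ModuleCat.subsingleton_of_isZero (isZero_sg_X n (n + 1) (by lia) N)
      exact ⟨_, w, Subsingleton.elim _ _, h⟩
  · have := ModuleCat.subsingleton_of_isZero (isZero_sg_X m n hn N)
    refine ⟨fun x y hx hy => ⟨0, Subsingleton.elim _ _⟩, fun y hy => ?_⟩
    obtain ⟨w, rfl⟩ := (K.isZero_homology_iff n).1 (van n hn) y hy
    exact ⟨0, w, map_zero _, by rw [map_zero, zero_add]⟩

variable [IsLocalRing R]

/-- The unit of the residue field. -/
def resOne (R : Type) [CommRing R] [IsLocalRing R] : resField R :=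
  (Ideal.Quotient.mk (IsLocalRing.maximalIdeal R) 1)

lemma exists_smul_resOne (z : resField R) : ∃ r : R, z = r • resOne R := by
  obtain ⟨r, rfl⟩ := Ideal.Quotient.mk_surjective z
  refine ⟨r, ?_⟩
  exact (congrArg (Ideal.Quotient.mk (IsLocalRing.maximalIdeal R)) (mul_one r).symm)

lemma smul_resField_eq_zero {r : R} (hr : r ∈ IsLocalRing.maximalIdeal R) (z : resField R) :
    r • z = 0 := by
  obtain ⟨s, rfl⟩ := Ideal.Quotient.mk_surjective z
  exact Ideal.Quotient.eq_zero_iff_mem.2 (Ideal.mul_mem_right s _ hr)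

lemma resField_hom_ext {N : ModuleCat R} {f g : resField R ⟶ N}
    (h : f (resOne R) = g (resOne R)) : f = g := by
  refine ModuleCat.hom_ext (LinearMap.ext fun z => ?_)
  obtain ⟨r, rfl⟩ := exists_smul_resOne z
  rw [map_smul, map_smul]
  exact congrArg (r • ·) h

lemma IsExtGenerator.units_smul {I : Cx R} {d : ℤ} {y : resField R ⟶ I.X d}
    (hy : IsExtGenerator I d y) (u : Rˣ) : IsExtGenerator I d ((u : R) • y) where
  comp_d := by rw [Linear.smul_comp, hy.comp_d, smul_zero]
  not_boundary g hg := hy.not_boundary ((↑u⁻¹ : R) • g) (by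
    rw [Linear.smul_comp, hg, smul_smul, Units.inv_mul, one_smul])
  generates f hf := by
    obtain ⟨r, g, rfl⟩ := hy.generates f hf
    exact ⟨r * (↑u⁻¹ : R), g, by rw [smul_smul, mul_assoc, Units.inv_mul, mul_one]⟩

lemma quasiIso_of_isExtGenerator {I : Cx R} {a d n m : ℤ} (h : IsDualizingInj R I a d)
    {y : resField R ⟶ I.X d} (hy : IsExtGenerator I d y) (hnm : m + n = d)
    (c : sg n (resField R) ⟶ homCx (sg m (resField R)) I)
    (hc : c.f n (sgIn n _ (resOne R)) = Cochain.fromSingleMk y hnm) : QuasiIso c := by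
  have hr : ∀ r : R, c.f n (sgIn n _ (r • resOne R)) = Cochain.fromSingleMk (r • y) hnm := by
    intro r
    rw [map_smul, map_smul, fromSingleMk_smul]
    exact congrArg (r • ·) hc
  refine quasiIso_of_sg c (fun j hj => ?_) (fun z w hw => ?_) (fun x hx => ?_)
  · rw [isZero_homology_homCx_sg_iff m j _ rfl]
    exact h.van _ (by lia)
  · obtain ⟨r, rfl⟩ := exists_smul_resOne z
    rw [hr] at hw
    obtain ⟨g, rfl⟩ := Cochain.fromSingleMk_surjective w (d - 1) (by lia)
    have hg := (δ_fromSingleMk_eq_iff (r • y) g hnm _).1 hw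
    by_contra hz
    have hu : IsUnit r := by
      by_contra hu
      exact hz (smul_resField_eq_zero ((IsLocalRing.mem_maximalIdeal r).2 hu) _)
    obtain ⟨u, rfl⟩ := hu
    exact (hy.units_smul u).not_boundary g hg
  · obtain ⟨f, rfl⟩ := Cochain.fromSingleMk_surjective x d hnm
    obtain ⟨r, g, rfl⟩ := hy.generates f ((δ_fromSingleMk_eq_zero_iff f hnm).1 hx)
    refine ⟨r • resOne R, Cochain.fromSingleMk g (by lia), ?_⟩
    rw [hr]
    refine ((Cochain.fromSingleEquiv hnm).symm.map_add (r • y) (g ≫ I.d (d - 1) d)).trans ?_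
    exact congrArg (Cochain.fromSingleMk (r • y) hnm + ·)
      (Cochain.δ_fromSingleMk g (by lia) n d hnm).symm

/-- The morphism from the residue field given by an element killed by the maximal ideal. -/
def resFieldDesc {N : ModuleCat R} (x : N) (hx : ∀ r ∈ IsLocalRing.maximalIdeal R, r • x = 0) :
    resField R ⟶ N :=
  ModuleCat.ofHom (Submodule.liftQ _ (LinearMap.toSpanSingleton R N x) hx)

lemma resFieldDesc_resOne {N : ModuleCat R} (x : N)
    (hx : ∀ r ∈ IsLocalRing.maximalIdeal R, r • x = 0) : resFieldDesc x hx (resOne R) = x :=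
  one_smul R x

lemma smul_fromSingleMk_resField_eq_zero {I : Cx R} {d n m : ℤ} (y : resField R ⟶ I.X d)
    (hnm : m + n = d) (r : R) (hr : r ∈ IsLocalRing.maximalIdeal R) :
    r • Cochain.fromSingleMk y hnm = 0 := by
  have : r • y = 0 := ModuleCat.hom_ext (LinearMap.ext fun z =>
    (y.hom.map_smul r z).symm.trans ((congrArg y.hom
      (smul_resField_eq_zero hr z)).trans y.hom.map_zero))
  rw [← fromSingleMk_smul, this, Cochain.fromSingleMk_zero]

/-- The morphism from a shift of the residue field to the dual of another shift. -/
def dualResField {I : Cx R} {d n m : ℤ} (y : resField R ⟶ I.X d) (hy : y ≫ I.d d (d + 1) = 0)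
    (hnm : m + n = d) : sg n (resField R) ⟶ homCx (sg m (resField R)) I :=
  sgDesc (resFieldDesc (N := (homCx (sg m (resField R)) I).X n) (Cochain.fromSingleMk y hnm)
    (smul_fromSingleMk_resField_eq_zero y hnm)) (resField_hom_ext (by
      refine (congrArg ((homCx (sg m (resField R)) I).d n (n + 1))
        (resFieldDesc_resOne _ _)).trans ?_
      exact (δ_fromSingleMk_eq_zero_iff y hnm).2 hy))

lemma dualResField_f {I : Cx R} {d n m : ℤ} (y : resField R ⟶ I.X d)
    (hy : y ≫ I.d d (d + 1) = 0) (hnm : m + n = d) :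
    (dualResField y hy hnm).f n (sgIn n _ (resOne R)) = Cochain.fromSingleMk y hnm :=
  (sgDesc_f_sgIn _ _ _).trans (resFieldDesc_resOne _ _)

lemma quasiIso_biduality_resField {I : Cx R} {a d : ℤ} (h : IsDualizingInj R I a d) (n : ℤ) :
    QuasiIso (biduality I (sg n (resField R))) := by
  obtain ⟨y, hy⟩ := h.one
  have := h.isKInjective
  obtain ⟨m, hm⟩ : ∃ m, n + m = d := ⟨d - n, by lia⟩
  let s := dualResField y hy.comp_d hm
  have hs : QuasiIso s := quasiIso_of_isExtGenerator h hy hm s (dualResField_f y hy.comp_d hm)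
  have hL : QuasiIso (homCx.mapL s I) := homCx.quasiIso_mapL s I
  have hc : QuasiIso (biduality I (sg n (resField R)) ≫ homCx.mapL s I) := by
    let ε : Rˣ := Units.map (Int.castRingHom R).toMonoidHom (m * n).negOnePow
    refine quasiIso_of_isExtGenerator h (hy.units_smul ε) (add_comm m n ▸ hm) _ ?_
    obtain ⟨g, hg⟩ := Cochain.fromSingleMk_surjective
      (homCx.toCochain ((biduality I (sg n (resField R)) ≫ homCx.mapL s I).f n
        (sgIn n _ (resOne R)))) d (add_comm m n ▸ hm)
    refine hg.symm.trans (congrArg (fun f => Cochain.fromSingleMk f _) (resField_hom_ext ?_))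
    refine (fromSingleMk_v_sgIn g (add_comm m n ▸ hm) (resOne R)).symm.trans ?_
    rw [hg]
    refine (congrArg (fun f => (ModuleCat.Hom.hom f) (sgIn m _ (resOne R)))
      (Cochain.zero_cochain_comp_v (Cochain.ofHom s) _ m d _)).trans ?_
    have e1 : ((Cochain.ofHom s).v m m (add_zero m)) (sgIn m _ (resOne R)) =
        Cochain.fromSingleMk y hm :=
      (congrArg (fun f => (ModuleCat.Hom.hom f) (sgIn m _ (resOne R)))
        (Cochain.ofHom_v s m)).trans (dualResField_f y hy.comp_d hm)
    have e2 := biduality_f_v I (sg n (resField R)) n m d (add_comm m n ▸ hm)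
      (sgIn n _ (resOne R)) (Cochain.fromSingleMk y hm)
    refine (congrArg (fun z => (homCx.toCochain ((biduality I (sg n (resField R))).f n
      (sgIn n _ (resOne R)))).v m d (add_comm m n ▸ hm) z) e1).trans (e2.trans ?_)
    refine (congrArg ((m * n).negOnePow • ·) (fromSingleMk_v_sgIn y hm (resOne R))).trans ?_
    change _ = (((m * n).negOnePow : ℤ) : R) • y (resOne R)
    rw [Int.cast_smul_eq_zsmul, Units.smul_def]
  exact quasiIso_of_comp_right _ (homCx.mapL s I)

end BidualityResidueField

section Biduality

variable {R : Type} [CommRing R]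

lemma homCx.mapL_smul_id (A B : Cx R) (x : R) :
    homCx.mapL (x • 𝟙 A) B = x • 𝟙 (homCx A B) :=
  HomologicalComplex.hom_ext _ _ fun _ => ModuleCat.hom_ext (LinearMap.ext fun z =>
    Cochain.ofHom_smul_id_comp x z)

lemma isZero_homCx_left {A : Cx R} (hA : IsZero A) (B : Cx R) : IsZero (homCx A B) := by
  rw [IsZero.iff_id_eq_zero]
  refine HomologicalComplex.hom_ext _ _ fun _ => ModuleCat.hom_ext (LinearMap.ext fun z => ?_)
  exact Cochain.ext _ _ fun p q hpq => ((HomologicalComplex.eval _ _ p).map_isZero hA).eq_of_src _ _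

lemma isZero_homCx_right (A : Cx R) {B : Cx R} (hB : IsZero B) : IsZero (homCx A B) := by
  rw [IsZero.iff_id_eq_zero]
  refine HomologicalComplex.hom_ext _ _ fun _ => ModuleCat.hom_ext (LinearMap.ext fun z => ?_)
  exact Cochain.ext _ _ fun p q hpq => ((HomologicalComplex.eval _ _ q).map_isZero hB).eq_of_tgt _ _

lemma quasiIso_of_isZero {A B : Cx R} (hA : IsZero A) (hB : IsZero B) (f : A ⟶ B) :
    QuasiIso f := by
  have : IsIso f := ⟨0, hA.eq_of_src _ _, hB.eq_of_src _ _⟩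
  infer_instance

/-- If the first map acts by zero on homology, the homology of the first two terms is detected
by the homology of the third one. -/
lemma bijective_of_homologyMap_eq_zero {S T : ShortComplex (Cx R)} (φ : S ⟶ T)
    (hS : S.ShortExact) (hT : T.ShortExact) (h₃ : QuasiIso φ.τ₃)
    (hSf : ∀ n y, HomologicalComplex.homologyMap S.f n y = 0)
    (hTf : ∀ n y, HomologicalComplex.homologyMap T.f n y = 0) (n : ℤ) :
    Function.Injective (HomologicalComplex.homologyMap φ.τ₂ n) ∧
      Function.Surjective (HomologicalComplex.homologyMap φ.τ₁ n) := by
  rw [quasiIso_iff] at h₃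
  simp only [Cx.quasiIsoAt_iff_bijective] at h₃
  constructor
  · rw [injective_iff_map_eq_zero]
    intro y hy
    have hc : HomologicalComplex.homologyMap φ.τ₂ n ≫ HomologicalComplex.homologyMap T.g n =
        HomologicalComplex.homologyMap S.g n ≫ HomologicalComplex.homologyMap φ.τ₃ n := by
      rw [← HomologicalComplex.homologyMap_comp, ← HomologicalComplex.homologyMap_comp, φ.comm₂₃]
    have hg : HomologicalComplex.homologyMap S.g n y = 0 := by
      refine (injective_iff_map_eq_zero _).1 (h₃ n).1 _ ?_
      refine (congrArg (fun f => (ModuleCat.Hom.hom f) y) hc).symm.trans ?_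
      exact (congrArg (HomologicalComplex.homologyMap T.g n) hy).trans (map_zero _)
    obtain ⟨x, rfl⟩ := (les_exact₂ hS n y).1 hg
    exact hSf n x
  · intro b
    obtain ⟨n, rfl⟩ : ∃ m, n = m + 1 := ⟨n - 1, by simp⟩
    obtain ⟨y', rfl⟩ := (les_exact₁ hT n b).1 (hTf (n + 1) b)
    obtain ⟨y, rfl⟩ := (h₃ n).2 y'
    refine ⟨hS.δ n (n + 1) rfl y, ?_⟩
    exact congrArg (fun f => (ModuleCat.Hom.hom f) y)
      (HomologicalComplex.HomologySequence.δ_naturality φ hS hT n (n + 1) rfl)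

lemma IsSemiprojResolution.isKProjective {F M : Cx R} {π : F ⟶ M} (h : IsSemiprojResolution π) :
    F.IsKProjective := by
  obtain ⟨hp, ⟨b, hb⟩, _⟩ := h
  have : F.IsStrictlyLE b := by
    rw [CochainComplex.isStrictlyLE_iff]
    exact fun i hi => hb i (by lia)
  exact CochainComplex.isKProjective_of_projective F b

lemma Cochain.smul_eq_δ {K B : Cx R} {n : ℤ} {x : R} {w : Cochain K K (-1)}
    (hw : δ (-1) 0 w = Cochain.ofHom (x • 𝟙 K)) (z : Cochain K B n) (hz : δ n (n + 1) z = 0) :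
    ∃ y : Cochain K B (n - 1), δ (n - 1) n y = x • z := by
  refine ⟨n.negOnePow • w.comp z (by lia), ?_⟩
  rw [δ_units_smul, δ_comp w z (by lia) 0 (n + 1) n (by lia) (by lia) (by lia), hz,
    Cochain.comp_zero, zero_add, hw, Cochain.ofHom_smul_id_comp, smul_smul, Int.units_mul_self,
    one_smul]

variable [IsLocalRing R]

lemma smul_homology_homCx_eq_zero {K : Cx R} {π : K ⟶ sg 0 (resField R)}
    (hπ : IsSemiprojResolution π) (B : Cx R) {x : R} (hx : x ∈ IsLocalRing.maximalIdeal R)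
    (n : ℤ) (y : (homCx K B).homology n) : x • y = 0 := by
  have := hπ.isKProjective
  have := hπ.2.2
  have hz : (Cochain.ofHom (x • 𝟙 K)).comp (Cochain.ofHom π) (add_zero 0) = 0 := by
    rw [Cochain.ofHom_smul_id_comp]
    refine Cochain.ext _ _ fun p q hpq => ModuleCat.hom_ext (LinearMap.ext fun z => ?_)
    by_cases hq : q = 0
    · subst hq
      obtain ⟨w, hw⟩ := sgIn_surjective 0 (resField R) ((Cochain.ofHom π).v p 0 hpq z)
      refine (congrArg (x • ·) hw.symm).trans ((map_smul _ x w).symm.trans ?_)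
      rw [smul_resField_eq_zero hx, map_zero]
      rfl
    · have := ModuleCat.subsingleton_of_isZero (isZero_sg_X 0 q hq (resField R))
      exact Subsingleton.elim _ _
  have hq := ((Cx.quasiIso_iff_elements _).1 (homCx.quasiIso_mapR K π) 0).1
  obtain ⟨w, hw⟩ := hq (Cochain.ofHom (x • 𝟙 K)) 0 (δ_ofHom _) ((map_zero _).trans hz.symm)
  obtain ⟨y, rfl⟩ := (homCx K B).cls_surjective n y
  rw [← map_smul, Cx.cls_eq_zero_iff]
  exact Cochain.smul_eq_δ hw y.1 y.2

variable [IsNoetherianRing R]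

lemma quasiIso_mapR_biduality {I : Cx R} {a d : ℤ} (h : IsDualizingInj R I a d) {K : Cx R}
    {π : K ⟶ sg 0 (resField R)} (hπ : IsSemiprojResolution π) (M : Cx R)
    (hM : HasFiniteHomology R M) : QuasiIso (homCx.mapR K (biduality I M)) := by
  have := h.inj
  have := h.isKInjective
  have := hπ.isKProjective
  have := hπ.1
  have hnat : ∀ {X Y : Cx R} (f : X ⟶ Y), homCx.mapR K (biduality I X) ≫
      homCx.mapR K (homCx.mapL (homCx.mapL f I) I) =
        homCx.mapR K f ≫ homCx.mapR K (biduality I Y) := fun f => by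
    rw [← homCx.mapR_comp, biduality_naturality, homCx.mapR_comp]
  let φ : ∀ S : ShortComplex (Cx R), homCx.shortComplexR K S ⟶
      homCx.shortComplexR K (homCx.shortComplexL I (homCx.shortComplexL I S)) := fun S =>
    { τ₁ := homCx.mapR K (biduality I S.X₁)
      τ₂ := homCx.mapR K (biduality I S.X₂)
      τ₃ := homCx.mapR K (biduality I S.X₃)
      comm₁₂ := hnat S.f
      comm₂₃ := hnat S.g }
  have hT : ∀ {S : ShortComplex (Cx R)}, S.ShortExact →
      (homCx.shortComplexR K (homCx.shortComplexL I (homCx.shortComplexL I S))).ShortExact :=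
    fun hS => homCx.shortExact_R K (homCx.shortExact_L I (homCx.shortExact_L I hS))
  refine local_devissage (fun M => QuasiIso (homCx.mapR K (biduality I M)))
    ?_ ?_ ?_ ?_ ?_ M hM
  · intro X Y f hf
    have := homCx.quasiIso_mapL f I
    have := homCx.quasiIso_mapL (homCx.mapL f I) I
    have := homCx.quasiIso_mapR K (homCx.mapL (homCx.mapL f I) I)
    have := homCx.quasiIso_mapR K f
    rw [← quasiIso_iff_comp_right (homCx.mapR K (biduality I X))
      (homCx.mapR K (homCx.mapL (homCx.mapL f I) I)), hnat, quasiIso_iff_comp_left]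
  · intro S hS h₁ h₃
    exact quasiIso_middle (φ S) (homCx.shortExact_R K hS) (hT hS) h₁ h₃
  · intro X hX
    exact quasiIso_of_isZero (isZero_homCx_right K hX)
      (isZero_homCx_right K (isZero_homCx_left (isZero_homCx_left hX I) I)) _
  · intro n
    have := quasiIso_biduality_resField h n
    exact homCx.quasiIso_mapR K _
  · intro X Y x g w hx _ hS hY
    have key := bijective_of_homologyMap_eq_zero (φ _) (homCx.shortExact_R K hS) (hT hS) hY
      (fun n y => (homologyMap_mapR_smul_id K X x n y).trans
        (smul_homology_homCx_eq_zero hπ _ hx n y))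
      (fun n y => by
        refine Eq.trans ?_ ((homologyMap_mapR_smul_id K (homCx (homCx X I) I) x n y).trans
          (smul_homology_homCx_eq_zero hπ _ hx n y))
        refine congrArg (fun f => (HomologicalComplex.homologyMap (homCx.mapR K f) n) y) ?_
        exact (congrArg (fun f => homCx.mapL f I) (homCx.mapL_smul_id X I x)).trans
          (homCx.mapL_smul_id _ I x))
    rw [quasiIso_iff]
    intro n
    rw [Cx.quasiIsoAt_iff_bijective]
    exact key n

end Biduality

section InjectiveModel

variable {R : Type} [CommRing R]

/-- The isomorphism on homology induced by a quasi-isomorphism. -/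
def Cx.homologyLinearEquiv {K L : Cx R} (f : K ⟶ L) [QuasiIso f] (n : ℤ) :
    K.homology n ≃ₗ[R] L.homology n :=
  (asIso (HomologicalComplex.homologyMap f n)).toLinearEquiv

lemma exists_injective_model (D : Cx.{0} R) (a : ℤ) (hD : ∀ n < a, IsZero (D.homology n)) :
    ∃ (I : Cx.{0} R) (j : D ⟶ I), QuasiIso j ∧ (∀ n, Injective (I.X n)) ∧ I.IsStrictlyGE a := by
  have : D.IsGE a := by
    rw [CochainComplex.isGE_iff]
    intro i hi
    rw [HomologicalComplex.exactAt_iff_isZero_homology]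
    exact hD i hi
  have : QuasiIso (D.πTruncGE a) := inferInstance
  obtain ⟨I, i, h1, h2, h3⟩ :=
    CochainComplex.Plus.modelCategoryQuillen.exists_quasiIso_injective (D.truncGE a) a
  exact ⟨I, D.πTruncGE a ≫ i, inferInstance, h2, h3⟩

variable [IsLocalRing R]

lemma exists_isDualizingInj {D : Cx.{0} R} (hD : IsNormalizedDualizingComplex R D) :
    ∃ (I : Cx.{0} R) (a d : ℤ), IsDualizingInj R I a d := by
  obtain ⟨a, ha⟩ := hD.homology_bounded
  obtain ⟨d, hd, hv⟩ := hD.ext_residue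
  obtain ⟨I, j, hj, hI, hge⟩ := exists_injective_model D a ha
  obtain ⟨K, π, hπ⟩ := exists_isSemiprojResolution (sg 0 (resField R))
    (hasFiniteHomology_sg 0 _ inferInstance)
  have := CochainComplex.isKInjective_of_injective I a
  have := hπ.isKProjective
  have := hπ.2.2
  have := homCx.quasiIso_mapR K j
  have := homCx.quasiIso_mapL π I
  let e : ∀ n, (homCx K D).homology n ≃ₗ[R] (homCx (sg 0 (resField R)) I).homology n := fun n =>
    (Cx.homologyLinearEquiv (homCx.mapR K j) n).trans
      (Cx.homologyLinearEquiv (homCx.mapL π I) n).symm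
  refine ⟨I, a, d, hI, hge, fun n => (finite_of_quasiIsoAt j n inferInstance).1
    (hD.finite_homology n), fun q hq => ?_, ?_⟩
  · rw [← isZero_homology_homCx_sg_iff 0 q q (zero_add q)]
    have h0 : IsZero ((homCx K D).homology q) :=
      (Cx.isZero_homology_iff _ _).2 (hv q hq K π hπ)
    exact h0.of_iso (e q).toModuleIso.symm
  · obtain ⟨e'⟩ := hd K π hπ
    let E : (homCx (sg 0 (resField R)) I).homology d ≃ₗ[R] resField R :=
      (e d).symm.trans ((homCx.extEquiv K D d).symm.trans e')
    obtain ⟨⟨z, hz⟩, hzy⟩ := Cx.cls_surjective _ d (E.symm (resOne R))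
    obtain ⟨y, rfl⟩ := Cochain.fromSingleMk_surjective z d (zero_add d)
    refine ⟨y, (δ_fromSingleMk_eq_zero_iff y (zero_add d)).1 hz, fun g hg => ?_, fun f hf => ?_⟩
    · have h0 := (Cx.cls_eq_zero_iff _ d ⟨_, hz⟩).2 ⟨Cochain.fromSingleMk g (zero_add _),
        (δ_fromSingleMk_eq_iff y g (zero_add d) _).2 hg⟩
      rw [hzy, LinearEquiv.map_eq_zero_iff] at h0
      exact one_ne_zero (α := R ⧸ IsLocalRing.maximalIdeal R) h0
    · have hf' := (δ_fromSingleMk_eq_zero_iff f (zero_add d)).2 hf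
      let u : LinearMap.ker ((homCx (sg 0 (resField R)) I).d d (d + 1)).hom :=
        ⟨Cochain.fromSingleMk f (zero_add d), hf'⟩
      obtain ⟨r, hr⟩ := exists_smul_resOne (E (Cx.cls _ d u))
      have hc : Cx.cls _ d (u - r • ⟨Cochain.fromSingleMk y (zero_add d), hz⟩) = 0 := by
        rw [map_sub, map_smul, hzy, ← map_smul, ← hr, LinearEquiv.symm_apply_apply, sub_self]
      obtain ⟨w, hw⟩ := (Cx.cls_eq_zero_iff _ d _).1 hc
      obtain ⟨g, rfl⟩ := Cochain.fromSingleMk_surjective w (d - 1) (zero_add _)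
      refine ⟨r, g, eq_add_of_sub_eq' ?_⟩
      refine ((δ_fromSingleMk_eq_iff (f - r • y) g (zero_add d) (zero_add _)).1 ?_).symm
      refine hw.trans (Eq.trans ?_ ((Cochain.fromSingleEquiv (zero_add d)).symm.map_sub f
        (r • y)).symm)
      exact congrArg (Cochain.fromSingleMk f (zero_add d) - ·)
        (fromSingleMk_smul r y (zero_add d)).symm

lemma nonempty_homology_dual_equiv {I : Cx R} {a d : ℤ} (h : IsDualizingInj R I a d)
    {K G X : Cx R} {π : K ⟶ sg 0 (resField R)} (hπ : IsSemiprojResolution π) {γ : G ⟶ X}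
    (hγ : IsSemiprojResolution γ) (i : ℤ) :
    Nonempty ((homCx K (homCx X I)).homology i ≃ₗ[R]
      (homCx G (sg d (resField R))).homology i) := by
  obtain ⟨y, hy⟩ := h.one
  have := h.isKInjective
  have := hπ.isKProjective
  have := hγ.isKProjective
  have := hπ.2.2
  have := hγ.2.2
  let s := dualResField y hy.comp_d (zero_add d)
  have : QuasiIso s := quasiIso_of_isExtGenerator h hy (zero_add d) s (dualResField_f y hy.comp_d _)
  have := homCx.quasiIso_mapL γ I
  have := homCx.quasiIso_mapL π I
  have := homCx.quasiIso_mapR K (homCx.mapL γ I)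
  have := homCx.quasiIso_mapR G (homCx.mapL π I)
  have := homCx.quasiIso_mapR G s
  exact ⟨(Cx.homologyLinearEquiv (homCx.mapR K (homCx.mapL γ I)) i).trans
    ((Cx.homologyLinearEquiv (homCx.swapIso K G I).hom i).trans
      ((Cx.homologyLinearEquiv (homCx.mapR G (homCx.mapL π I)) i).symm.trans
        (Cx.homologyLinearEquiv (homCx.mapR G s) i).symm))⟩

end InjectiveModel

section TensorResidueField

open MonoidalCategory TensorProduct

variable {R : Type} [CommRing R] [IsLocalRing R]

/-- The tensor product of a complex with the residue field. -/
abbrev tensorRes (F : Cx R) : Cx R := HomologicalComplex.tensorObj F (sgl (resField R))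

/-- The pure tensors with the unit of the residue field. -/
def tmulResOne (N : ModuleCat R) :
    N ⟶ N ⊗ (sgl (resField R)).X 0 :=
  ModuleCat.ofHom ((TensorProduct.mk R N ((sgl (resField R)).X 0)).flip
    (sgIn 0 (resField R) (resOne R)))

/-- The canonical map `F.X p ⟶ (F ⊗ k).X p`. -/
def toTensorRes (F : Cx R) (p : ℤ) : F.X p ⟶ (tensorRes F).X p :=
  tmulResOne (F.X p) ≫ HomologicalComplex.ιTensorObj F (sgl (resField R)) p 0 p (add_zero p)

lemma d₂_tensorRes (F : Cx R) (i₁ i₂ j : ℤ) :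
    HomologicalComplex.mapBifunctor.d₂ F (sgl (resField R)) (curriedTensor (ModuleCat R))
      (.up ℤ) i₁ i₂ j = 0 := by
  by_cases h₂ : ComplexShape.π (.up ℤ) (.up ℤ) (.up ℤ) (i₁, i₂ + 1) = j
  · rw [HomologicalComplex.mapBifunctor.d₂_eq _ _ _ _ _ (show (ComplexShape.up ℤ).Rel i₂ (i₂ + 1)
      from rfl) _ h₂, HomologicalComplex.single_obj_d, Functor.map_zero, zero_comp, smul_zero]
  · rw [HomologicalComplex.mapBifunctor.d₂_eq_zero' _ _ _ _ _
      (show (ComplexShape.up ℤ).Rel i₂ (i₂ + 1) from rfl) _ h₂]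

lemma tmulResOne_naturality {N N' : ModuleCat R} (f : N ⟶ N') :
    tmulResOne N ≫ f ▷ _ = f ≫ tmulResOne N' := rfl

lemma toTensorRes_comm (F : Cx R) (p q : ℤ) :
    toTensorRes F p ≫ (tensorRes F).d p q = F.d p q ≫ toTensorRes F q := by
  by_cases h : (ComplexShape.up ℤ).Rel p q
  · have hd : HomologicalComplex.ιTensorObj F (sgl (resField R)) p 0 p (add_zero p) ≫
        (tensorRes F).d p q = (F.d p q) ▷ _ ≫
        HomologicalComplex.ιTensorObj F (sgl (resField R)) q 0 q (add_zero q) := by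
      rw [HomologicalComplex.mapBifunctor.d_eq, Preadditive.comp_add,
        HomologicalComplex.mapBifunctor.ι_D₁, HomologicalComplex.mapBifunctor.ι_D₂,
        d₂_tensorRes, add_zero,
        HomologicalComplex.mapBifunctor.d₁_eq _ _ _ _ h _ _ (add_zero q)]
      exact one_smul _ _
    rw [toTensorRes, toTensorRes, Category.assoc, hd, ← Category.assoc, ← Category.assoc,
      tmulResOne_naturality]
  · rw [HomologicalComplex.shape _ _ _ h, HomologicalComplex.shape _ _ _ h, comp_zero, zero_comp]

lemma epi_tmulResOne (N : ModuleCat R) : Epi (tmulResOne N) := by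
  rw [ModuleCat.epi_iff_surjective]
  intro z
  induction z using TensorProduct.induction_on with
  | zero => exact ⟨0, map_zero _⟩
  | tmul x y =>
    obtain ⟨y, rfl⟩ := sgIn_surjective 0 (resField R) y
    obtain ⟨r, rfl⟩ := exists_smul_resOne y
    refine ⟨r • x, ?_⟩
    rw [map_smul (sgIn 0 (resField R)).hom]
    exact TensorProduct.smul_tmul _ _ _
  | add x y hx hy =>
    obtain ⟨a, rfl⟩ := hx
    obtain ⟨b, rfl⟩ := hy
    exact ⟨a + b, map_add _ _ _⟩

lemma toTensorRes_surjective (F : Cx R) (p : ℤ) : Function.Surjective (toTensorRes F p) := by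
  rw [← ModuleCat.epi_iff_surjective]
  refine ⟨fun {Z} f g hfg => HomologicalComplex.mapBifunctor.hom_ext fun i₁ i₂ h => ?_⟩
  have h' : i₁ + i₂ = p := h
  by_cases h₂ : i₂ = 0
  · subst h₂
    obtain rfl : i₁ = p := by lia
    have := epi_tmulResOne (F.X i₁)
    rw [← cancel_epi (tmulResOne (F.X i₁))]
    rw [toTensorRes, Category.assoc, Category.assoc] at hfg
    exact hfg
  · refine ModuleCat.hom_ext (TensorProduct.ext' fun x y => ?_)
    have := ModuleCat.subsingleton_of_isZero (isZero_sg_X 0 i₂ h₂ (resField R))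
    have hy : y = 0 := @Subsingleton.elim _ this _ _
    rw [hy, TensorProduct.tmul_zero, map_zero, map_zero]

lemma toTensorRes_smul (F : Cx R) (p : ℤ) {r : R} (hr : r ∈ IsLocalRing.maximalIdeal R)
    (x : F.X p) : toTensorRes F p (r • x) = 0 := by
  have : tmulResOne (F.X p) (r • x) = 0 := by
    refine (TensorProduct.smul_tmul r x (sgIn 0 (resField R) (resOne R))).trans ?_
    rw [← map_smul (sgIn 0 (resField R)).hom, smul_resField_eq_zero hr, map_zero]
    exact TensorProduct.tmul_zero _ _
  exact (congrArg (HomologicalComplex.ιTensorObj F (sgl (resField R)) p 0 p (add_zero p))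
    this).trans (map_zero _)

lemma exists_toTensorRes_comp (F : Cx R) (p : ℤ) (g : F.X p ⟶ resField R) :
    ∃ g' : (tensorRes F).X p ⟶ resField R, toTensorRes F p ≫ g' = g := by
  let e (i₁ : ℤ) : F.X i₁ ⟶ resField R := if h : i₁ = p then (F.XIsoOfEq h).hom ≫ g else 0
  let c (i₂ : ℤ) : (sgl (resField R)).X i₂ ⟶ resField R :=
    if h : i₂ = 0 then (HomologicalComplex.singleObjXIsoOfEq (.up ℤ) 0 (resField R) i₂ h).hom else 0
  let m : resField R ⊗ resField R ⟶ resField R :=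
    ModuleCat.ofHom (LinearMap.mul' R (R ⧸ IsLocalRing.maximalIdeal R))
  refine ⟨HomologicalComplex.mapBifunctorDesc fun i₁ i₂ _ => (e i₁ ⊗ₘ c i₂) ≫ m, ?_⟩
  rw [toTensorRes, Category.assoc, HomologicalComplex.ι_mapBifunctorDesc]
  have he : e p = g := by simp [e]
  have hc : c 0 (sgIn 0 (resField R) (resOne R)) = resOne R := by
    have : sgIn 0 (resField R) ≫ c 0 = 𝟙 _ := by
      simp only [c, dif_pos]
      exact Iso.inv_hom_id _
    exact congrArg (fun f : resField R ⟶ resField R => f (resOne R)) this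
  refine ModuleCat.hom_ext (LinearMap.ext fun x => ?_)
  rw [← he]
  change (e p x : R ⧸ IsLocalRing.maximalIdeal R) * c 0 (sgIn 0 (resField R) (resOne R)) = e p x
  rw [hc]
  exact mul_one _

end TensorResidueField

section TensorResidueFieldDual

variable {R : Type} [CommRing R]

lemma length_eq_top_of_not_finite {A V : Type} [Ring A] [AddCommGroup V] [Module A V]
    (h : ¬ Module.Finite A V) : Module.length A V = ⊤ := by
  by_contra hl
  have := (isFiniteLength_iff_isNoetherian_isArtinian.1 (Module.length_ne_top_iff.1 hl)).1
  exact h inferInstance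

lemma length_eq_of_ker_eq {A B C : Type} [AddCommGroup A] [Module R A] [AddCommGroup B]
    [Module R B] [AddCommGroup C] [Module R C] {u : A →ₗ[R] B} {v : A →ₗ[R] C}
    (hu : Function.Surjective u) (hv : Function.Surjective v)
    (h : LinearMap.ker u = LinearMap.ker v) : Module.length R B = Module.length R C :=
  (((u.quotKerEquivOfSurjective hu).symm.trans (Submodule.quotEquivOfEq _ _ h)).trans
    (v.quotKerEquivOfSurjective hv)).length_eq

lemma Cx.smul_homology_eq_zero {K : Cx R} {n : ℤ} {r : R} (h : ∀ x : K.X n, r • x = 0)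
    (y : K.homology n) : r • y = 0 := by
  obtain ⟨y, rfl⟩ := K.cls_surjective n y
  rw [← map_smul, show r • y = 0 from Subtype.ext (h y.1), map_zero]

lemma Cochain.toSingleMk_smul {F : Cx R} {p q n : ℤ} {N : ModuleCat.{0} R} (r : R) (f : F.X p ⟶ N)
    (h : p + n = q) : Cochain.toSingleMk (r • f) h = r • Cochain.toSingleMk f h := by
  refine (Cochain.toSingleEquiv h).injective ?_
  rw [Cochain.toSingleEquiv_toSingleMk]
  refine Eq.trans ?_ (Linear.smul_comp _ _ _ r _ _).symm
  exact congrArg (r • ·) (Cochain.toSingleEquiv_toSingleMk f h).symm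

lemma modLength_eq_length (A N : Type) [CommRing A] [AddCommGroup N] [Module A N] :
    modLength A N = (Module.length A N : WithBot ℕ∞) := (Module.coe_length A N).symm

variable [IsLocalRing R]

lemma exists_extend_of_smul_eq_zero {V : Type} [AddCommGroup V] [Module R V]
    (hV : ∀ r ∈ IsLocalRing.maximalIdeal R, ∀ v : V, r • v = 0) (S : Submodule R V)
    {N : Type} [AddCommGroup N] [Module R N] (φ : S →ₗ[R] N) :
    ∃ ψ : V →ₗ[R] N, ψ ∘ₗ S.subtype = φ := by
  have hT : Module.IsTorsionBySet R V (IsLocalRing.maximalIdeal R) := fun v r => hV r.1 r.2 v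
  let := hT.module
  let : Field (R ⧸ IsLocalRing.maximalIdeal R) := Ideal.Quotient.field _
  have hs : IsSemisimpleModule (R ⧸ IsLocalRing.maximalIdeal R) V := inferInstance
  have hs' : IsSemisimpleModule R V := hT.isSemisimpleModule_iff.1 hs
  obtain ⟨T, hST⟩ := exists_isCompl S
  refine ⟨φ ∘ₗ S.projectionOnto T hST, ?_⟩
  ext x
  simp

lemma length_linearMap_of_equiv_residue {V : Type} [AddCommGroup V] [Module R V]
    (hV : ∀ r ∈ IsLocalRing.maximalIdeal R, ∀ v : V, r • v = 0)
    {N : Type} [AddCommGroup N] [Module R N] (e : N ≃ₗ[R] R ⧸ IsLocalRing.maximalIdeal R) :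
    Module.length R (V →ₗ[R] N) = Module.length R V := by
  have hT : Module.IsTorsionBySet R V (IsLocalRing.maximalIdeal R) := fun v r => hV r.1 r.2 v
  let := hT.module
  let : Field (R ⧸ IsLocalRing.maximalIdeal R) := Ideal.Quotient.field _
  have : IsScalarTower R (R ⧸ IsLocalRing.maximalIdeal R) V := hT.isScalarTower
  have hsurj : Function.Surjective (algebraMap R (R ⧸ IsLocalRing.maximalIdeal R)) :=
    Ideal.Quotient.mk_surjective
  let e' : (V →ₗ[R] N) ≃ₗ[R] Module.Dual (R ⧸ IsLocalRing.maximalIdeal R) V :=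
    (LinearEquiv.congrRight e).trans (LinearMap.extendScalarsOfSurjectiveEquiv hsurj)
  rw [e'.length_eq, Module.length_eq_of_surjective hsurj,
    Module.length_eq_of_surjective (M := V) hsurj]
  by_cases hf : Module.Finite (R ⧸ IsLocalRing.maximalIdeal R) V
  · rw [Module.length_eq_finrank, Module.length_eq_finrank, Subspace.dual_finrank_eq]
  · have hf' : ¬ Module.Finite (R ⧸ IsLocalRing.maximalIdeal R)
        (Module.Dual (R ⧸ IsLocalRing.maximalIdeal R) V) := by
      rwa [Module.finite_dual_iff]
    rw [length_eq_top_of_not_finite hf, length_eq_top_of_not_finite hf']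

lemma smul_tensorRes_eq_zero (F : Cx R) (p : ℤ) {r : R} (hr : r ∈ IsLocalRing.maximalIdeal R)
    (w : (tensorRes F).X p) : r • w = 0 := by
  obtain ⟨x, rfl⟩ := toTensorRes_surjective F p w
  rw [← map_smul, toTensorRes_smul F p hr]

/-- The cochain with values in the residue field attached to a functional on `F ⊗ k`. -/
def dualTensorRes (F : Cx R) {N : ModuleCat.{0} R} {p j e : ℤ} (h : p + j = e) :
    ((tensorRes F).X p →ₗ[R] N) →ₗ[R] (homCx F (sg e (N))).X j where
  toFun g := Cochain.toSingleMk (toTensorRes F p ≫ ModuleCat.ofHom g) h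
  map_add' g g' := by
    refine Eq.trans ?_ (Cochain.toSingleMk_add _ _ h)
    rfl
  map_smul' r g := Cochain.toSingleMk_smul r (toTensorRes F p ≫ ModuleCat.ofHom g) h

lemma dualTensorRes_injective (F : Cx R) {N : ModuleCat.{0} R} {p j e : ℤ} (h : p + j = e) :
    Function.Injective (dualTensorRes F (N := N) h) := by
  intro g g' hg
  have h₁ := (Cochain.toSingleEquiv h).symm.injective hg
  refine LinearMap.ext fun w => ?_
  obtain ⟨x, rfl⟩ := toTensorRes_surjective F p w
  exact congrArg (fun f : F.X p ⟶ N => f x) h₁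

lemma dualTensorRes_surjective (F : Cx R) {N : ModuleCat.{0} R}
    (hN : ∀ p (g : F.X p ⟶ N), ∃ g', toTensorRes F p ≫ g' = g) {p j e : ℤ} (h : p + j = e) :
    Function.Surjective (dualTensorRes F (N := N) h) := by
  intro z
  obtain ⟨f, rfl⟩ := Cochain.toSingleMk_surjective z p h
  obtain ⟨g, rfl⟩ := hN p f
  exact ⟨g.hom, rfl⟩

lemma d_dualTensorRes (F : Cx R) {N : ModuleCat.{0} R} {p j e p' j' : ℤ} (h : p + j = e)
    (h' : p' + j' = e) (g : (tensorRes F).X p →ₗ[R] N) :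
    (homCx F (sg e (N))).d j j' (dualTensorRes F h g) =
      j'.negOnePow • dualTensorRes F h' (g ∘ₗ ((tensorRes F).d p' p).hom) := by
  refine (Cochain.δ_toSingleMk (toTensorRes F p ≫ ModuleCat.ofHom g) h j' p' h').trans ?_
  refine congrArg (fun f => j'.negOnePow • Cochain.toSingleMk f h') ?_
  exact congrArg (fun f => f ≫ ModuleCat.ofHom g) (toTensorRes_comm F p' p).symm

lemma d_dualTensorRes_eq_zero_iff (F : Cx R) {N : ModuleCat.{0} R} {p j e p' j' : ℤ} (h : p + j = e)
    (h' : p' + j' = e) (g : (tensorRes F).X p →ₗ[R] N) :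
    (homCx F (sg e (N))).d j j' (dualTensorRes F h g) = 0 ↔
      g ∘ₗ ((tensorRes F).d p' p).hom = 0 := by
  rw [d_dualTensorRes F h h', smul_eq_zero_iff_eq,
    map_eq_zero_iff _ (dualTensorRes_injective F h')]

/-- The functionals on `F ⊗ k` vanishing on boundaries. -/
abbrev dualCycles (F : Cx R) (N : ModuleCat.{0} R) (p : ℤ) :
    Submodule R ((tensorRes F).X p →ₗ[R] N) :=
  LinearMap.ker (LinearMap.lcomp R N ((tensorRes F).d (p - 1) p).hom)

/-- The cohomology class of a functional vanishing on boundaries. -/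
def dualCyclesToHomology (F : Cx R) {N : ModuleCat.{0} R} {p j e : ℤ} (h : p + j = e) :
    dualCycles F N p →ₗ[R] (homCx F (sg e (N))).homology j :=
  (homCx F (sg e (N))).cls j ∘ₗ LinearMap.codRestrict _
    (dualTensorRes F h ∘ₗ (dualCycles F N p).subtype) fun g =>
      (d_dualTensorRes_eq_zero_iff F h (p' := p - 1) (by lia) g.1).2 g.2

lemma dualCyclesToHomology_surjective (F : Cx R) {N : ModuleCat.{0} R}
    (hN : ∀ p (g : F.X p ⟶ N), ∃ g', toTensorRes F p ≫ g' = g) {p j e : ℤ} (h : p + j = e) :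
    Function.Surjective (dualCyclesToHomology F (N := N) h) := by
  intro y
  obtain ⟨⟨z, hz⟩, rfl⟩ := Cx.cls_surjective _ _ y
  obtain ⟨g, rfl⟩ := dualTensorRes_surjective F hN h z
  exact ⟨⟨g, (d_dualTensorRes_eq_zero_iff F h (p' := p - 1) (by lia) g).1 hz⟩, rfl⟩

lemma dualCyclesToHomology_eq_zero_iff (F : Cx R) {N : ModuleCat.{0} R}
    (hN : ∀ p (g : F.X p ⟶ N), ∃ g', toTensorRes F p ≫ g' = g) {p j e : ℤ} (h : p + j = e)
    (g : dualCycles F N p) : dualCyclesToHomology F h g = 0 ↔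
      ∃ f : (tensorRes F).X (p + 1) →ₗ[R] N,
        f ∘ₗ ((tensorRes F).d p (p + 1)).hom = g.1 := by
  have h' : (p + 1) + (j - 1) = e := by lia
  refine (Cx.cls_eq_zero_iff _ _ _).trans ⟨?_, ?_⟩
  · rintro ⟨y, hy⟩
    obtain ⟨f, rfl⟩ := dualTensorRes_surjective F hN h' y
    rw [d_dualTensorRes F h' h] at hy
    obtain hs | hs := Int.units_eq_one_or j.negOnePow
    · rw [hs, one_smul] at hy
      exact ⟨f, dualTensorRes_injective F h hy⟩
    · rw [hs, Units.neg_smul, one_smul, ← map_neg] at hy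
      exact ⟨-f, dualTensorRes_injective F h hy⟩
  · rintro ⟨f, hf⟩
    refine ⟨j.negOnePow • dualTensorRes F h' f, ?_⟩
    have hd := d_dualTensorRes F h' h f
    rw [hf] at hd
    obtain hs | hs := Int.units_eq_one_or j.negOnePow
    · rw [hs, one_smul] at hd ⊢
      exact hd
    · rw [hs, Units.neg_smul, one_smul] at hd ⊢
      rw [map_neg, hd, neg_neg]
      rfl

/-- A functional vanishing on boundaries induces a functional on homology. -/
def dualCyclesToDual (F : Cx R) (N : ModuleCat.{0} R) (p : ℤ) : dualCycles F N p →ₗ[R]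
    ((↥(LinearMap.ker ((tensorRes F).d p (p + 1)).hom) ⧸
      (Submodule.comap (LinearMap.ker ((tensorRes F).d p (p + 1)).hom).subtype
        (LinearMap.range ((tensorRes F).d (p - 1) p).hom))) →ₗ[R] N) where
  toFun g := Submodule.liftQ _ (g.1 ∘ₗ Submodule.subtype _) (by
    rintro x ⟨y, hy⟩
    rw [LinearMap.mem_ker]
    exact (congrArg g.1 hy.symm).trans (LinearMap.congr_fun (LinearMap.mem_ker.1 g.2) y))
  map_add' g g' := Submodule.linearMap_qext _ rfl
  map_smul' r g := Submodule.linearMap_qext _ rfl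

lemma dualCyclesToDual_surjective (F : Cx R) (N : ModuleCat.{0} R) (p : ℤ) :
    Function.Surjective (dualCyclesToDual F N p) := by
  intro φ
  obtain ⟨ψ, hψ⟩ := exists_extend_of_smul_eq_zero
    (fun r hr w => smul_tensorRes_eq_zero F p hr w) _ (φ ∘ₗ Submodule.mkQ _)
  refine ⟨⟨ψ, LinearMap.mem_ker.2 (LinearMap.ext fun y => ?_)⟩, Submodule.linearMap_qext _ hψ⟩
  refine (LinearMap.congr_fun hψ ⟨((tensorRes F).d (p - 1) p).hom y,
    Cx.d_d_apply _ _ _ _ y⟩).trans ?_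
  refine (congrArg φ ?_).trans (map_zero φ)
  exact (Submodule.Quotient.mk_eq_zero _).2 ⟨y, rfl⟩

lemma dualCyclesToDual_eq_zero_iff (F : Cx R) (N : ModuleCat.{0} R) (p : ℤ) (g : dualCycles F N p) :
    dualCyclesToDual F N p g = 0 ↔ ∃ f : (tensorRes F).X (p + 1) →ₗ[R] N,
        f ∘ₗ ((tensorRes F).d p (p + 1)).hom = g.1 := by
  constructor
  · intro h
    have h₀ : LinearMap.ker ((tensorRes F).d p (p + 1)).hom ≤ LinearMap.ker g.1 := fun x hx =>
      LinearMap.congr_fun h (Submodule.Quotient.mk ⟨x, hx⟩)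
    let φ := (Submodule.liftQ _ g.1 h₀) ∘ₗ
      ((tensorRes F).d p (p + 1)).hom.quotKerEquivRange.symm.toLinearMap
    obtain ⟨ψ, hψ⟩ := exists_extend_of_smul_eq_zero
      (fun r hr w => smul_tensorRes_eq_zero F (p + 1) hr w) _ φ
    refine ⟨ψ, LinearMap.ext fun x => ?_⟩
    refine (LinearMap.congr_fun hψ ⟨_, LinearMap.mem_range_self _ x⟩).trans ?_
    refine (congrArg (Submodule.liftQ _ g.1 h₀)
      (LinearMap.quotKerEquivRange_symm_apply_image _ x (LinearMap.mem_range_self _ x))).trans rfl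
  · rintro ⟨f, hf⟩
    refine Submodule.linearMap_qext _ (LinearMap.ext fun x => ?_)
    refine (LinearMap.congr_fun hf.symm x.1).trans ?_
    exact (congrArg f x.2).trans (map_zero f)

lemma length_homology_homCx_sg (F : Cx R) {N : ModuleCat.{0} R}
    (hN : ∀ p (g : F.X p ⟶ N), ∃ g', toTensorRes F p ≫ g' = g)
    (e : N ≃ₗ[R] R ⧸ IsLocalRing.maximalIdeal R) {p j n : ℤ} (h : p + j = n) :
    Module.length R ((homCx F (sg n N)).homology j) =
      Module.length R ((tensorRes F).homology p) := by
  have hk : LinearMap.ker (dualCyclesToHomology F (N := N) h) =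
      LinearMap.ker (dualCyclesToDual F N p) := by
    ext g
    rw [LinearMap.mem_ker, LinearMap.mem_ker, dualCyclesToHomology_eq_zero_iff F hN,
      dualCyclesToDual_eq_zero_iff]
  rw [length_eq_of_ker_eq (dualCyclesToHomology_surjective F hN h)
    (dualCyclesToDual_surjective F N p) hk, ← ((tensorRes F).homologyEquiv p).length_eq]
  refine length_linearMap_of_equiv_residue (fun r hr v => ?_) e
  obtain ⟨v, rfl⟩ := ((tensorRes F).homologyEquiv p).symm.surjective v
  rw [← map_smul, Cx.smul_homology_eq_zero (smul_tensorRes_eq_zero F p hr), map_zero]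

lemma length_homology_tensorRes (F : Cx R) {p j n : ℤ} (h : p + j = n) :
    Module.length R ((homCx F (sg n (resField R))).homology j) =
      Module.length R ((tensorRes F).homology p) :=
  length_homology_homCx_sg F (exists_toTensorRes_comp F) (LinearEquiv.refl R _) h

end TensorResidueFieldDual

section Duality

variable {R : Type} [CommRing R]

lemma convCoeff_shift (c : Polynomial ℤ) (p : ℤ → ℕ) (s i : ℤ) :
    convCoeff c (fun j => p (j + s)) i = convCoeff c p (i + s) := by
  refine Finset.sum_congr rfl fun j _ => ?_
  dsimp only
  rw [show i - (j : ℤ) + s = i + s - j by ring]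

variable [IsLocalRing R]

lemma isPoincareCoeffs_iff {M : Cx.{0} R} {p : ℤ → ℕ} : IsPoincareCoeffs R M p ↔
    ∀ (F : Cx R) (π : F ⟶ M), IsSemiprojResolution π → ∀ i : ℤ,
      Module.length R ((tensorRes F).homology (-i)) = p i := by
  refine forall_congr' fun F => forall_congr' fun π => forall_congr' fun _ =>
    forall_congr' fun i => ?_
  rw [modLength_eq_length]
  exact WithBot.coe_inj

lemma isBassCoeffs_iff {M : Cx.{0} R} {q : ℤ → ℕ} : IsBassCoeffs R M q ↔
    ∀ (F : Cx R) (π : F ⟶ sg 0 (resField R)), IsSemiprojResolution π → ∀ i : ℤ,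
      Module.length R ((homCx F M).homology i) = q i := by
  refine forall_congr' fun F => forall_congr' fun π => forall_congr' fun _ =>
    forall_congr' fun i => ?_
  rw [modLength_eq_length, (homCx.extEquiv F M i).length_eq]
  exact WithBot.coe_inj

lemma isBassCoeffs_dual {I : Cx R} {a d : ℤ} (h : IsDualizingInj R I a d) {M : Cx R}
    (hM : HasFiniteHomology R M) {p : ℤ → ℕ} (hp : IsPoincareCoeffs R M p) :
    IsBassCoeffs R (homCx M I) (fun i => p (i + -d)) := by
  rw [isBassCoeffs_iff]
  intro K π hπ i
  obtain ⟨G, γ, hγ⟩ := exists_isSemiprojResolution M hM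
  obtain ⟨e⟩ := nonempty_homology_dual_equiv h hπ hγ i
  rw [e.length_eq, length_homology_tensorRes G (p := -(i + -d)) (by ring)]
  exact isPoincareCoeffs_iff.1 hp G γ hγ _

variable [IsNoetherianRing R]

lemma isPoincareCoeffs_dual {I : Cx R} {a d : ℤ} (h : IsDualizingInj R I a d) {M : Cx R}
    (hM : HasFiniteHomology R M) {q : ℤ → ℕ} (hq : IsBassCoeffs R M q) :
    IsPoincareCoeffs R (homCx M I) (fun i => q (i + d)) := by
  rw [isPoincareCoeffs_iff]
  intro G γ hγ i
  obtain ⟨K, π, hπ⟩ := exists_isSemiprojResolution (sg 0 (resField R))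
    (hasFiniteHomology_sg 0 _ inferInstance)
  obtain ⟨e⟩ := nonempty_homology_dual_equiv h hπ hγ (i + d)
  have := quasiIso_mapR_biduality h hπ M hM
  rw [← length_homology_tensorRes G (p := -i) (j := i + d) (n := d) (by ring), ← e.length_eq]
  refine ((Cx.homologyLinearEquiv (homCx.mapR K (biduality I M)) (i + d)).length_eq).symm.trans ?_
  exact isBassCoeffs_iff.1 hq K π hπ _

lemma poincare_laurent_iff_bass_laurent {I : Cx R} {a d : ℤ} (h : IsDualizingInj R I a d)
    (c : Polynomial ℤ) :
    (∀ M : Cx.{0} R, HasFiniteHomology R M → ∀ p : ℤ → ℕ, IsPoincareCoeffs R M p →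
        ∃ a b : ℤ, ∀ i : ℤ, (i < a ∨ b < i) → convCoeff c p i = 0) ↔
      (∀ M : Cx.{0} R, HasFiniteHomology R M → ∀ q : ℤ → ℕ, IsBassCoeffs R M q →
        ∃ a b : ℤ, ∀ i : ℤ, (i < a ∨ b < i) → convCoeff c q i = 0) := by
  constructor
  · intro H M hM q hq
    obtain ⟨a, b, hab⟩ := H _ (h.finite_dual M hM) _ (isPoincareCoeffs_dual h hM hq)
    refine ⟨a + d, b + d, fun i hi => ?_⟩
    simpa [convCoeff_shift] using hab (i - d) (by omega)
  · intro H M hM p hp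
    obtain ⟨a, b, hab⟩ := H _ (h.finite_dual M hM) _ (isBassCoeffs_dual h hM hp)
    refine ⟨a - d, b - d, fun i hi => ?_⟩
    simpa [convCoeff_shift] using hab (i + d) (by omega)

end Duality

section ResidueDual

variable {R : Type} [CommRing R]

/-- The morphisms `N ⟶ I.X q` whose composition with the differential vanishes. -/
def sgCocycles (N : ModuleCat.{0} R) (I : Cx.{0} R) (q : ℤ) : Submodule R (N ⟶ I.X q) :=
  LinearMap.ker (Linear.rightComp R N (I.d q (q + 1)))

/-- The cocycle in `Hom(sg n N, I)` attached to a morphism `N ⟶ I.X q`. -/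
def sgCocyclesToKer (N : ModuleCat.{0} R) (I : Cx.{0} R) {n j q : ℤ} (h : n + j = q) :
    sgCocycles N I q →ₗ[R] LinearMap.ker ((homCx (sg n N) I).d j (j + 1)).hom where
  toFun f := ⟨Cochain.fromSingleMk f.1 h, (δ_fromSingleMk_eq_zero_iff f.1 h).2 f.2⟩
  map_add' f g := Subtype.ext (Cochain.fromSingleMk_add f.1 g.1 h)
  map_smul' r f := Subtype.ext (fromSingleMk_smul r f.1 h)

/-- The cohomology class in `Hom(sg n N, I)` of a morphism `N ⟶ I.X q`. -/
def sgCocyclesToHomology (N : ModuleCat.{0} R) (I : Cx.{0} R) {n j q : ℤ} (h : n + j = q) :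
    sgCocycles N I q →ₗ[R] (homCx (sg n N) I).homology j :=
  ((homCx (sg n N) I).cls j).comp (sgCocyclesToKer N I h)

lemma sgCocyclesToHomology_surjective (N : ModuleCat.{0} R) (I : Cx.{0} R) {n j q : ℤ}
    (h : n + j = q) : Function.Surjective (sgCocyclesToHomology N I h) := by
  refine ((homCx (sg n N) I).cls_surjective j).comp ?_
  rintro ⟨z, hz⟩
  obtain ⟨f, rfl⟩ := Cochain.fromSingleMk_surjective z q h
  exact ⟨⟨f, (δ_fromSingleMk_eq_zero_iff f h).1 hz⟩, rfl⟩

lemma sgCocyclesToHomology_eq_zero_iff (N : ModuleCat.{0} R) (I : Cx.{0} R) {n j q : ℤ}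
    (h : n + j = q) (f : sgCocycles N I q) : sgCocyclesToHomology N I h f = 0 ↔
      ∃ g : N ⟶ I.X (q - 1), g ≫ I.d (q - 1) q = f.1 := by
  refine ((homCx (sg n N) I).cls_eq_zero_iff j (sgCocyclesToKer N I h f)).trans ?_
  constructor
  · rintro ⟨z, hz⟩
    obtain ⟨g, rfl⟩ := Cochain.fromSingleMk_surjective z (q - 1) (by omega)
    exact ⟨g, (δ_fromSingleMk_eq_iff f.1 g h _).1 hz⟩
  · rintro ⟨g, hg⟩
    exact ⟨Cochain.fromSingleMk g (by omega), (δ_fromSingleMk_eq_iff f.1 g h _).2 hg⟩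

lemma length_homology_homCx_sg_shift (N : ModuleCat.{0} R) (I : Cx.{0} R) {n j n' j' : ℤ}
    (h : n + j = n' + j') : Module.length R ((homCx (sg n N) I).homology j) =
      Module.length R ((homCx (sg n' N) I).homology j') := by
  refine length_eq_of_ker_eq (sgCocyclesToHomology_surjective N I h)
    (sgCocyclesToHomology_surjective N I rfl) ?_
  ext f
  rw [LinearMap.mem_ker, LinearMap.mem_ker, sgCocyclesToHomology_eq_zero_iff,
    sgCocyclesToHomology_eq_zero_iff]

variable [IsLocalRing R]

lemma length_ne_top_of_smul_eq_zero {V : Type} [AddCommGroup V] [Module R V] [Module.Finite R V]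
    (hV : ∀ r ∈ IsLocalRing.maximalIdeal R, ∀ v : V, r • v = 0) : Module.length R V ≠ ⊤ := by
  have hT : Module.IsTorsionBySet R V (IsLocalRing.maximalIdeal R) := fun v r => hV r.1 r.2 v
  let := hT.module
  let : Field (R ⧸ IsLocalRing.maximalIdeal R) := Ideal.Quotient.field _
  have : IsScalarTower R (R ⧸ IsLocalRing.maximalIdeal R) V := hT.isScalarTower
  have hsurj : Function.Surjective (algebraMap R (R ⧸ IsLocalRing.maximalIdeal R)) :=
    Ideal.Quotient.mk_surjective
  have : Module.Finite (R ⧸ IsLocalRing.maximalIdeal R) V :=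
    Module.Finite.of_restrictScalars_finite R _ _
  rw [Module.length_eq_of_surjective hsurj, Module.length_eq_finrank]
  exact ENat.natCast_ne_top _

lemma Cochain.smul_resField_eq_zero {G : Cx R} {n j : ℤ} (z : Cochain G (sg n (resField R)) j)
    {r : R} (hr : r ∈ IsLocalRing.maximalIdeal R) : r • z = 0 := by
  refine Cochain.ext _ _ fun p q hpq => ?_
  rw [Cochain.smul_v]
  by_cases hq : q = n
  · subst hq
    refine ModuleCat.hom_ext (LinearMap.ext fun x => ?_)
    obtain ⟨w, hw⟩ := sgIn_surjective q (resField R) (z.v p q hpq x)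
    refine (congrArg (r • ·) hw.symm).trans ?_
    change r • sgIn q (resField R) w = 0
    rw [← map_smul, _root_.smul_resField_eq_zero hr, map_zero]
  · exact (isZero_sg_X n q hq _).eq_of_tgt _ _

/-- `J` is a nonnegatively graded injective resolution of the residue field. -/
structure IsResidueInj (J : Cx.{0} R) : Prop where
  inj : ∀ n, Injective (J.X n)
  ge : J.IsStrictlyGE 0
  res : ∃ j : sg 0 (resField R) ⟶ J, QuasiIso j

lemma exists_isResidueInj : ∃ J : Cx.{0} R, IsResidueInj J := by
  obtain ⟨J, j, hj, hinj, hge⟩ := exists_injective_model (sg 0 (resField R)) 0 fun n hn => by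
    rw [← HomologicalComplex.exactAt_iff_isZero_homology]
    exact HomologicalComplex.exactAt_single_obj _ _ _ _ hn.ne
  exact ⟨J, hinj, hge, j, hj⟩

namespace IsResidueInj

variable {J : Cx.{0} R}

lemma isKInjective (hJ : IsResidueInj J) : J.IsKInjective :=
  have := hJ.inj
  have := hJ.ge
  CochainComplex.isKInjective_of_injective J 0

lemma isZero_homology (hJ : IsResidueInj J) {n : ℤ} (hn : n ≠ 0) : IsZero (J.homology n) := by
  obtain ⟨j, hj⟩ := hJ.res
  rw [← isZero_homology_iff_of_quasiIsoAt j n inferInstance,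
    ← HomologicalComplex.exactAt_iff_isZero_homology]
  exact HomologicalComplex.exactAt_single_obj _ _ _ _ hn

lemma nonempty_homology_equiv (hJ : IsResidueInj J) {M G : Cx.{0} R} {γ : G ⟶ M}
    (hγ : IsSemiprojResolution γ) (i : ℤ) : Nonempty ((homCx M J).homology i ≃ₗ[R]
      (homCx G (sg 0 (resField R))).homology i) := by
  obtain ⟨j, hj⟩ := hJ.res
  have := hJ.isKInjective
  have := hγ.isKProjective
  have := hγ.2.2
  have := homCx.quasiIso_mapL γ J
  have := homCx.quasiIso_mapR G j
  exact ⟨(Cx.homologyLinearEquiv (homCx.mapL γ J) i).trans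
    (Cx.homologyLinearEquiv (homCx.mapR G j) i).symm⟩

lemma isPoincareCoeffs_iff (hJ : IsResidueInj J) {M : Cx.{0} R} (hM : HasFiniteHomology R M)
    {p : ℤ → ℕ} : IsPoincareCoeffs R M p ↔
      ∀ i, Module.length R ((homCx M J).homology i) = p i := by
  have key : ∀ (G : Cx.{0} R) (γ : G ⟶ M), IsSemiprojResolution γ → ∀ i,
      Module.length R ((tensorRes G).homology (-i)) =
        Module.length R ((homCx M J).homology i) := fun G γ hγ i => by
    obtain ⟨e⟩ := hJ.nonempty_homology_equiv hγ i
    rw [e.length_eq, length_homology_tensorRes G (neg_add_cancel i)]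
  rw [_root_.isPoincareCoeffs_iff]
  refine ⟨fun h i => ?_, fun h G γ hγ i => (key G γ hγ i).trans (h i)⟩
  obtain ⟨G, γ, hγ⟩ := exists_isSemiprojResolution M hM
  rw [← key G γ hγ, h G γ hγ]

variable [IsNoetherianRing R]

lemma exists_isPoincareCoeffs (hJ : IsResidueInj J) {M : Cx.{0} R} (hM : HasFiniteHomology R M) :
    ∃ p, IsPoincareCoeffs R M p := by
  simp only [hJ.isPoincareCoeffs_iff hM]
  obtain ⟨G, γ, hγ⟩ := exists_isSemiprojResolution M hM
  have hl : ∀ i, Module.length R ((homCx M J).homology i) ≠ ⊤ := fun i => by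
    obtain ⟨e⟩ := hJ.nonempty_homology_equiv hγ i
    obtain ⟨j, hj⟩ := hJ.res
    have := hJ.inj
    have := hJ.ge
    have : Module.Finite R ((homCx M J).homology i) := finite_dual J 0 (fun n =>
      (finite_of_quasiIsoAt j n inferInstance).1
        ((hasFiniteHomology_sg 0 (resField R) inferInstance).1 n)) M hM i
    refine length_ne_top_of_smul_eq_zero fun r hr v => e.injective ?_
    rw [map_smul, map_zero]
    exact Cx.smul_homology_eq_zero (fun x => Cochain.smul_resField_eq_zero x hr) _
  exact ⟨fun i => (Module.length R ((homCx M J).homology i)).toNat,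
    fun i => (ENat.natCast_toNat (hl i)).symm⟩

end IsResidueInj

end ResidueDual

section Tail

variable {R : Type} [CommRing R]

lemma convCoeff_congr {c : Polynomial ℤ} {p p' : ℤ → ℕ} {i : ℤ}
    (h : ∀ j ∈ c.support, p (i - j) = p' (i - j)) : convCoeff c p i = convCoeff c p' i :=
  Finset.sum_congr rfl fun j hj => by rw [h j hj]

lemma convCoeff_eq_zero {c : Polynomial ℤ} {p : ℤ → ℕ} {i : ℤ}
    (h : ∀ j ≤ i, p j = 0) : convCoeff c p i = 0 :=
  Finset.sum_eq_zero fun j _ => by rw [h _ (by omega), Nat.cast_zero, mul_zero]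

lemma exists_cone {M : Cx.{0} R} {b : ℤ} {L : ModuleCat.{0} R} (f : sg b L ⟶ M) :
    ∃ (C : Cx.{0} R) (u : M ⟶ C) (v : C ⟶ sg (b - 1) L) (w : u ≫ v = 0),
      (ShortComplex.mk u v w).ShortExact ∧ ∀ n, HomologicalComplex.homologyMap (f ≫ u) n = 0 := by
  let S := CochainComplex.mappingCone.triangleRotateShortComplex f
  have hS : S.ShortExact := HomologicalComplex.shortExact_of_degreewise_shortExact _ fun n =>
    (CochainComplex.mappingCone.triangleRotateShortComplexSplitting f n).shortExact
  let ι : S.X₃ ≅ sg (b - 1) L :=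
    ((CochainComplex.singleFunctors (ModuleCat R)).shiftIso 1 (b - 1) b (by ring)).app L
  have w : S.f ≫ S.g ≫ ι.hom = 0 := by rw [← Category.assoc, S.zero, zero_comp]
  let e : S ≅ ShortComplex.mk S.f (S.g ≫ ι.hom) w :=
    ShortComplex.isoMk (Iso.refl _) (Iso.refl _) ι (by simp) (by simp)
  refine ⟨S.X₂, S.f, S.g ≫ ι.hom, w, ShortComplex.shortExact_of_iso e hS, fun n => ?_⟩
  exact (Homotopy.homologyMap_eq (HomologicalComplex.homotopyCofiber.inrCompHomotopy f
    fun j => ⟨j - 1, by simp⟩) n).trans (HomologicalComplex.homologyMap_zero _ _ _)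

lemma exists_surjective_homologyMap_sg (M : Cx.{0} R) (b : ℤ)
    (hM : Module.Finite R (M.homology b)) :
    ∃ (L : ModuleCat.{0} R) (f : sg b L ⟶ M), Projective L ∧ Module.Finite R L ∧
      Function.Surjective (HomologicalComplex.homologyMap f b) := by
  obtain ⟨n, s, hs⟩ := Module.Finite.exists_fin (R := R) (M := M.homology b)
  choose z hz using fun i => M.cls_surjective b (s i)
  let ψ : (Fin n → R) →ₗ[R] LinearMap.ker (M.d b (b + 1)).hom := Fintype.linearCombination R z
  let φ : ModuleCat.of R (Fin n → R) ⟶ M.X b := ModuleCat.ofHom (Submodule.subtype _ ∘ₗ ψ)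
  have hφ : φ ≫ M.d b (b + 1) = 0 :=
    ModuleCat.hom_ext (LinearMap.ext fun x => (ψ x).2)
  refine ⟨_, sgDesc φ hφ, ?_, inferInstanceAs (Module.Finite R (Fin n → R)), fun y => ?_⟩
  · exact (IsProjective.iff_projective _ ).1 (inferInstanceAs (Module.Projective R (Fin n → R)))
  · have hy : y ∈ Submodule.span R (Set.range s) := hs ▸ Submodule.mem_top
    rw [Submodule.mem_span_range_iff_exists_fun] at hy
    obtain ⟨r, rfl⟩ := hy
    have := ModuleCat.subsingleton_of_isZero
      (isZero_sg_X b (b + 1) (by lia) (ModuleCat.of R (Fin n → R)))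
    refine ⟨Cx.cls _ b ⟨sgIn b _ r, Subsingleton.elim _ _⟩, ?_⟩
    refine (Cx.homologyMap_cls (sgDesc φ hφ) b _ (ψ r) (sgDesc_f_sgIn φ hφ r)).trans ?_
    simp [ψ, Fintype.linearCombination_apply, hz]

lemma length_homology_homCx_eq_of_shortExact (I : Cx.{0} R) [∀ n, Injective (I.X n)]
    {S : ShortComplex (Cx.{0} R)} (hS : S.ShortExact) (i : ℤ)
    (h : IsZero ((homCx S.X₃ I).homology i)) (h' : IsZero ((homCx S.X₃ I).homology (i + 1))) :
    Module.length R ((homCx S.X₁ I).homology i) = Module.length R ((homCx S.X₂ I).homology i) := by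
  have hL := homCx.shortExact_L I hS
  have := ModuleCat.subsingleton_of_isZero h
  have := ModuleCat.subsingleton_of_isZero h'
  refine (LinearEquiv.ofBijective (HomologicalComplex.homologyMap (homCx.mapL S.f I) i).hom
    ⟨?_, fun y => ?_⟩).length_eq.symm
  · refine (injective_iff_map_eq_zero _).2 fun x hx => ?_
    obtain ⟨y, rfl⟩ := (les_exact₂ hL i x).1 hx
    exact (congrArg _ (@Subsingleton.elim _ ‹Subsingleton ((homCx S.X₃ I).homology i)› y 0)).trans
      (map_zero _)
  · exact (les_exact₃ hL i y).1 (@Subsingleton.elim _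
      ‹Subsingleton ((homCx S.X₃ I).homology (i + 1))› _ _)

lemma isGE_of_isZero_homology {M : Cx.{0} R} {a : ℤ} (h : ∀ i < a, IsZero (M.homology i)) :
    M.IsGE a := by
  rw [CochainComplex.isGE_iff]
  intro i hi
  rw [HomologicalComplex.exactAt_iff_isZero_homology]
  exact h i hi

lemma isLE_of_isZero_homology {M : Cx.{0} R} {a : ℤ} (h : ∀ i, a < i → IsZero (M.homology i)) :
    M.IsLE a := by
  rw [CochainComplex.isLE_iff]
  intro i hi
  rw [HomologicalComplex.exactAt_iff_isZero_homology]
  exact h i hi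

/-- In high degrees the numerical invariants of `Hom(M, J)` agree with those of a finite module. -/
def HasModuleTail (J M : Cx.{0} R) : Prop :=
  ∃ (N : ModuleCat.{0} R) (n i₀ : ℤ), Module.Finite R N ∧ ∀ i, i₀ ≤ i →
    Module.length R ((homCx M J).homology i) = Module.length R ((homCx (sg n N) J).homology i)

variable [IsLocalRing R] {J : Cx.{0} R}

lemma IsResidueInj.exists_isZero_homology_homCx (hJ : IsResidueInj J) {M : Cx.{0} R}
    (hM : HasFiniteHomology R M) : ∃ a : ℤ, ∀ i < a, IsZero ((homCx M J).homology i) := by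
  have := hJ.isKInjective
  have := hJ.inj
  have := hJ.ge
  refine complex_devissage (fun M => ∃ a : ℤ, ∀ i < a, IsZero ((homCx M J).homology i))
    (fun {X Y} f _ => ?_) ?_ (fun n N _ => ⟨-n, fun i hi => ?_⟩) M hM
  · have := homCx.quasiIso_mapL f J
    simp only [fun i => isZero_homology_iff_of_quasiIsoAt (homCx.mapL f J) i inferInstance]
  · rintro S hS ⟨a, ha⟩ ⟨b, hb⟩
    exact ⟨min a b, fun i hi => isZero_of_exact _ _ (les_exact₂ (homCx.shortExact_L J hS) i)
      (hb i (by omega)) (ha i (by omega))⟩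
  · exact isZero_homology_homCx_sg_of_lt n i 0 (by omega) N J

variable [IsNoetherianRing R]

lemma IsResidueInj.hasModuleTail_of_isZero (hJ : IsResidueInj J) (a : ℤ) (k : ℕ) :
    ∀ M : Cx.{0} R, (∀ i, Module.Finite R (M.homology i)) → (∀ i < a, IsZero (M.homology i)) →
      (∀ i, a + k < i → IsZero (M.homology i)) → HasModuleTail J M := by
  induction k with
  | zero =>
    intro M hf ha hb
    rw [Nat.cast_zero, add_zero] at hb
    have := isGE_of_isZero_homology ha
    have := isLE_of_isZero_homology hb
    have := hJ.isKInjective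
    refine complex_devissage_single (HasModuleTail J) (fun {X Y} f _ => ?_)
      (fun n N hN => ⟨N, n, 0, hN, fun _ _ => rfl⟩) a M hf
    have := homCx.quasiIso_mapL f J
    simp only [HasModuleTail, (Cx.homologyLinearEquiv (homCx.mapL f J) _).length_eq]
  | succ k ih =>
    intro M hf ha hb
    obtain ⟨L, f, hL, hLf, hsurj⟩ := exists_surjective_homologyMap_sg M (a + k + 1) (hf _)
    obtain ⟨C, u, v, w, hS, hz⟩ := exists_cone f
    have h₃ := hasFiniteHomology_sg (a + k + 1 - 1) L hLf
    have hne : ∀ i, i ≠ a + k + 1 - 1 → IsZero ((sg (a + k + 1 - 1) L).homology i) := fun i hi => by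
      rw [← HomologicalComplex.exactAt_iff_isZero_homology]
      exact HomologicalComplex.exactAt_single_obj _ _ _ _ hi
    have hex := les_exact₂ hS
    obtain ⟨N, n, i₀, hN, hi₀⟩ := ih C (fun i => finite_of_exact _ _ (hex i) (hf i) (h₃.1 i))
      (fun i hi => isZero_of_exact _ _ (hex i) (ha i hi) (hne i (by omega))) fun i hi => by
        by_cases hib : i = a + k + 1
        · subst hib
          rw [ModuleCat.isZero_iff_subsingleton]
          have := ModuleCat.subsingleton_of_isZero (hne (a + k + 1) (by omega))
          refine subsingleton_of_forall_eq 0 fun y => ?_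
          obtain ⟨x, rfl⟩ := (hex _ y).1 (Subsingleton.elim _ _)
          obtain ⟨t, rfl⟩ := hsurj x
          have ht := hz (a + k + 1)
          rw [HomologicalComplex.homologyMap_comp] at ht
          exact congrArg (fun g => g t) ht
        · exact isZero_of_exact _ _ (hex i) (hb i (by push_cast; omega)) (hne i (by omega))
    refine ⟨N, n, max i₀ (1 - (a + k)), hN, fun i hi => ?_⟩
    have := hJ.inj
    rw [← hi₀ i (by omega)]
    refine length_homology_homCx_eq_of_shortExact J hS i ?_ ?_
    · exact isZero_homology_homCx_sg_of_projective _ _ _ rfl L J (hJ.isZero_homology (by omega))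
    · exact isZero_homology_homCx_sg_of_projective _ _ _ rfl L J (hJ.isZero_homology (by omega))

lemma IsResidueInj.hasModuleTail (hJ : IsResidueInj J) {M : Cx.{0} R}
    (hM : HasFiniteHomology R M) : HasModuleTail J M := by
  obtain ⟨hf, a, b, hab⟩ := hM
  exact hJ.hasModuleTail_of_isZero a (b - a).toNat M hf (fun i hi => hab i (Or.inl hi))
    fun i hi => hab i (Or.inr (by omega))

lemma poincare_polynomial_iff_poincare_laurent (c : Polynomial ℤ) :
    (∀ (M : ModuleCat.{0} R), Module.Finite R M → ∀ p : ℤ → ℕ,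
        IsPoincareCoeffs R (sgl M) p →
          (∀ i : ℤ, i < 0 → convCoeff c p i = 0) ∧
          (∃ N : ℤ, ∀ i : ℤ, N ≤ i → convCoeff c p i = 0)) ↔
      (∀ M : Cx.{0} R, HasFiniteHomology R M → ∀ p : ℤ → ℕ, IsPoincareCoeffs R M p →
        ∃ a b : ℤ, ∀ i : ℤ, (i < a ∨ b < i) → convCoeff c p i = 0) := by
  obtain ⟨J, hJ⟩ := exists_isResidueInj (R := R)
  have hzero : ∀ {M : Cx.{0} R} (_ : HasFiniteHomology R M) {p : ℤ → ℕ}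
      (_ : IsPoincareCoeffs R M p) {a : ℤ} (_ : ∀ i < a, IsZero ((homCx M J).homology i)),
      ∀ i < a, convCoeff c p i = 0 := fun {M} hM {p} hp {a} ha i hi => by
    refine convCoeff_eq_zero fun j hj => ?_
    have := ModuleCat.subsingleton_of_isZero (ha j (by omega))
    have h := (hJ.isPoincareCoeffs_iff hM).1 hp j
    rw [Module.length_eq_zero] at h
    exact_mod_cast h.symm
  constructor
  · intro H M hM p hp
    obtain ⟨N, n, i₀, hN, hi₀⟩ := hJ.hasModuleTail hM
    obtain ⟨a, ha⟩ := hJ.exists_isZero_homology_homCx hM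
    have hN₀ := hasFiniteHomology_sg 0 N hN
    obtain ⟨p', hp'⟩ := hJ.exists_isPoincareCoeffs hN₀
    obtain ⟨b, hb⟩ := (H N hN p' hp').2
    refine ⟨a, max (b - n) (i₀ + c.natDegree), fun i hi => ?_⟩
    rcases hi with hi | hi
    · exact hzero hM hp ha i hi
    · rw [← hb (i + n) (by omega), ← convCoeff_shift]
      refine convCoeff_congr fun j hj => ?_
      have hj' := Polynomial.le_natDegree_of_mem_supp j hj
      have h := hi₀ (i - j) (by omega)
      rw [(hJ.isPoincareCoeffs_iff hM).1 hp, length_homology_homCx_sg_shift N J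
        (n' := 0) (j' := i - j + n) (by ring), (hJ.isPoincareCoeffs_iff hN₀).1 hp'] at h
      exact_mod_cast h
  · intro H M hM p hp
    have hM₀ := hasFiniteHomology_sg 0 M hM
    have := hJ.ge
    obtain ⟨a, b, hab⟩ := H _ hM₀ p hp
    refine ⟨hzero hM₀ hp fun i hi => isZero_homology_homCx_sg_of_lt 0 i 0 (by omega) M J,
      b + 1, fun i hi => hab i (Or.inr (by omega))⟩

end Tail

/-- Let `(R, 𝔪, k)` be a commutative noetherian local ring with a
dualizing complex and `c(t) ∈ ℤ[t]`.  The following are equivalent: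
(1) `c(t)·P^R_M(t) ∈ ℤ[t]` for every finitely generated `R`-module `M`;
(2) `c(t)·P^R_M(t) ∈ ℤ[t,t⁻¹]` for every complex `M` with finite homology;
(3) `c(t)·I_R^M(t) ∈ ℤ[t,t⁻¹]` for every complex `M` with finite homology. -/
theorem poincare_polynomial_iff_poincare_laurent_iff_bass_laurent
    (R : Type) [CommRing R] [IsNoetherianRing R] [IsLocalRing R]
    (hdc : ∃ D : Cx R, IsNormalizedDualizingComplex R D)
    (c : Polynomial ℤ) :
    ((∀ (M : ModuleCat R), Module.Finite R M → ∀ p : ℤ → ℕ,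
        IsPoincareCoeffs R (sgl M) p →
          (∀ i : ℤ, i < 0 → convCoeff c p i = 0) ∧
          (∃ N : ℤ, ∀ i : ℤ, N ≤ i → convCoeff c p i = 0)) ↔
      (∀ M : Cx R, HasFiniteHomology R M → ∀ p : ℤ → ℕ, IsPoincareCoeffs R M p →
        ∃ a b : ℤ, ∀ i : ℤ, (i < a ∨ b < i) → convCoeff c p i = 0)) ∧
    ((∀ M : Cx R, HasFiniteHomology R M → ∀ p : ℤ → ℕ, IsPoincareCoeffs R M p →
        ∃ a b : ℤ, ∀ i : ℤ, (i < a ∨ b < i) → convCoeff c p i = 0) ↔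
      (∀ M : Cx R, HasFiniteHomology R M → ∀ q : ℤ → ℕ, IsBassCoeffs R M q →
        ∃ a b : ℤ, ∀ i : ℤ, (i < a ∨ b < i) → convCoeff c q i = 0)) := by
  obtain ⟨D, hD⟩ := hdc
  obtain ⟨I, a, d, hI⟩ := exists_isDualizingInj hD
  exact ⟨poincare_polynomial_iff_poincare_laurent c, poincare_laurent_iff_bass_laurent hI c⟩
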